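/- Let H be a minimal counterexample to the main theorem: a plane graph with Δ(H)=6, containing no subgraph isomorphic to a diamond or a house, in which every 6-vertex either is not incident with two 4-cycles sharing an edge or is not incident with three cycles of sizes p,q,ℓ for any {p,q,ℓ} ∈ {{3,4,4},{3,3,4}}, that is not totally 7-colorable, and that minimizes |V(H)|+|E(H)| among all such graphs. Then H contains no vertex v of degree 6 with three distinct neighbors x1, x2, x3 of degree exactly 2 and a neighbor y of degree exactly 3 (all distinct) such that: the neighbors of y are v, u2 and u3; the neighbor u1 of x1 other than v is adjacent to u2; and u3 is the neighbor of x2 other than v. -/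

import Mathlib

open SimpleGraph

/-- The degree of a vertex, as `Nat.card` of its neighbor set. -/
noncomputable def vdeg {V : Type*} (G : SimpleGraph V) (v : V) : ℕ :=
  Nat.card (G.neighborSet v)

/-- `G` has maximum degree exactly `k`. -/
def MaxDegreeEq {V : Type*} (G : SimpleGraph V) (k : ℕ) : Prop :=
  (∀ v, vdeg G v ≤ k) ∧ ∃ v, vdeg G v = k

/-- `G` admits a total `k`-coloring: a coloring of vertices and edges with `k` colors such
that adjacent vertices get distinct colors, edges sharing an endpoint get distinct colors,
and each edge gets a color distinct from those of its endpoints. -/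
def TotallyColorable {V : Type*} (G : SimpleGraph V) (k : ℕ) : Prop :=
  ∃ (cv : V → Fin k) (ce : Sym2 V → Fin k),
    (∀ ⦃u v⦄, G.Adj u v → cv u ≠ cv v) ∧
    (∀ e₁ ∈ G.edgeSet, ∀ e₂ ∈ G.edgeSet, e₁ ≠ e₂ → (∃ x, x ∈ e₁ ∧ x ∈ e₂) →
      ce e₁ ≠ ce e₂) ∧
    (∀ ⦃u v⦄, G.Adj u v → ce s(u, v) ≠ cv u)

/-- The diamond: `K₄` minus one edge. -/
def diamondGraph : SimpleGraph (Fin 4) :=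
  SimpleGraph.fromEdgeSet {s(0, 1), s(0, 2), s(0, 3), s(1, 2), s(1, 3)}

/-- The house: a `4`-cycle `1 2 3 4` and a triangle `0 1 4` sharing exactly the edge `{1,4}`
(equivalently, a `5`-cycle plus one chord). -/
def houseGraph : SimpleGraph (Fin 5) :=
  SimpleGraph.fromEdgeSet {s(0, 1), s(1, 2), s(2, 3), s(3, 4), s(4, 0), s(1, 4)}

/-- `G` contains a (not necessarily induced) subgraph isomorphic to `H`. -/
def ContainsCopy {α β : Type*} (H : SimpleGraph α) (G : SimpleGraph β) : Prop :=
  ∃ f : α → β, Function.Injective f ∧ ∀ ⦃u v⦄, H.Adj u v → G.Adj (f u) (f v)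

/-- `v` is incident with two distinct `4`-cycles of `G` that share an edge. -/
def TwoAdjacentFourCyclesAt {V : Type*} (G : SimpleGraph V) (v : V) : Prop :=
  ∃ (c₁ c₂ : G.Walk v v), c₁.IsCycle ∧ c₂.IsCycle ∧ c₁.length = 4 ∧ c₂.length = 4 ∧
    {e | e ∈ c₁.edges} ≠ {e | e ∈ c₂.edges} ∧ ∃ e, e ∈ c₁.edges ∧ e ∈ c₂.edges

/-- `v` is incident with three pairwise distinct cycles of `G`, of lengths `p`, `q`, `ℓ`. -/
def ThreeCyclesAt {V : Type*} (G : SimpleGraph V) (v : V) (p q ℓ : ℕ) : Prop :=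
  ∃ (c₁ c₂ c₃ : G.Walk v v), c₁.IsCycle ∧ c₂.IsCycle ∧ c₃.IsCycle ∧
    c₁.length = p ∧ c₂.length = q ∧ c₃.length = ℓ ∧
    {e | e ∈ c₁.edges} ≠ {e | e ∈ c₂.edges} ∧
    {e | e ∈ c₁.edges} ≠ {e | e ∈ c₃.edges} ∧
    {e | e ∈ c₂.edges} ≠ {e | e ∈ c₃.edges}

/-- Every `6`-vertex of `G` is not incident with two `4`-cycles sharing an edge, or is not
incident with three cycles of sizes `p, q, ℓ` for any `{p,q,ℓ} ∈ {{3,4,4},{3,3,4}}`. -/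
def Good6Vertices {V : Type*} (G : SimpleGraph V) : Prop :=
  ∀ v, vdeg G v = 6 →
    (¬ TwoAdjacentFourCyclesAt G v) ∨
    (∀ p q ℓ : ℕ, (({p, q, ℓ} : Multiset ℕ) = {3, 4, 4} ∨ ({p, q, ℓ} : Multiset ℕ) = {3, 3, 4}) →
      ¬ ThreeCyclesAt G v p q ℓ)

/-- Reversal of darts, as a permutation. -/
def dartRev {V : Type*} (G : SimpleGraph V) : Equiv.Perm G.Dart :=
  Function.Involutive.toPerm SimpleGraph.Dart.symm SimpleGraph.Dart.symm_involutive

/-- A rotation system (combinatorial embedding) of `G`: a permutation of the darts whose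
orbits are exactly the sets of darts emanating from each single vertex. -/
structure RotationSystem {V : Type*} (G : SimpleGraph V) where
  σ : Equiv.Perm G.Dart
  tail_fixed : ∀ d : G.Dart, (σ d).fst = d.fst
  vertex_cycles : ∀ d d' : G.Dart, d.fst = d'.fst → σ.SameCycle d d'

namespace RotationSystem

variable {V : Type*} {G : SimpleGraph V}

/-- The face-tracing permutation of a rotation system. -/
def φ (R : RotationSystem G) : Equiv.Perm G.Dart :=
  R.σ * dartRev G

/-- Two darts lie on the same face iff they are in the same orbit of the face-tracing
permutation. -/
def faceSetoid (R : RotationSystem G) : Setoid G.Dart where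
  r := R.φ.SameCycle
  iseqv := ⟨fun d => Equiv.Perm.SameCycle.refl _ d, Equiv.Perm.SameCycle.symm,
    Equiv.Perm.SameCycle.trans⟩

/-- The faces of the embedding: orbits of the face-tracing permutation. -/
def Faces (R : RotationSystem G) : Type _ :=
  Quotient R.faceSetoid

/-- The number of faces of the embedding. -/
noncomputable def numFaces (R : RotationSystem G) : ℕ :=
  Nat.card R.Faces

/-- The darts of the face containing the dart `d`. -/
def faceDarts (R : RotationSystem G) (d : G.Dart) : Set G.Dart :=
  {d' | R.φ.SameCycle d d'}

/-- The degree (length of the boundary walk, cut edges counted twice) of the face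
containing the dart `d`. -/
noncomputable def faceDeg (R : RotationSystem G) (d : G.Dart) : ℕ :=
  (R.faceDarts d).ncard

/-- The vertex `v` is incident with the face containing the dart `d`. -/
def FaceIncident (R : RotationSystem G) (v : V) (d : G.Dart) : Prop :=
  ∃ d' ∈ R.faceDarts d, d'.fst = v

/-- A rotation system is a plane embedding when it satisfies Euler's formula
`|V| - |E| + |F| = 2` on each connected component, i.e. `|V| + |F| = |E| + 2c`. -/
def IsPlanarEmbedding [Fintype V] (R : RotationSystem G) : Prop :=
  Fintype.card V + R.numFaces = Nat.card G.edgeSet + 2 * Nat.card G.ConnectedComponent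

end RotationSystem

/-- A graph is planar if it admits a plane embedding. -/
def IsPlanar {V : Type*} [Fintype V] (G : SimpleGraph V) : Prop :=
  ∃ R : RotationSystem G, R.IsPlanarEmbedding

/-- Conditions (1), (2), (3) on graphs in Theorem 1: planar of maximum degree 6, with no
diamond and no house subgraph, and every 6-vertex not incident with two adjacent 4-cycles
or not incident with three cycles of sizes in `{{3,4,4},{3,3,4}}`. -/
def GoodGraph {V : Type*} [Fintype V] (G : SimpleGraph V) : Prop :=
  IsPlanar G ∧ MaxDegreeEq G 6 ∧ ¬ ContainsCopy diamondGraph G ∧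
    ¬ ContainsCopy houseGraph G ∧ Good6Vertices G

/-- `H` is a minimal counterexample to the main theorem: it satisfies conditions (1)–(3),
is not totally 7-colorable, and minimizes `|V| + |E|` among all such graphs. -/
def MinimalCounterexample {V : Type*} [Fintype V] (H : SimpleGraph V) : Prop :=
  GoodGraph H ∧ ¬ TotallyColorable H 7 ∧
    ∀ (n : ℕ) (G : SimpleGraph (Fin n)), GoodGraph G → ¬ TotallyColorable G 7 →
      Fintype.card V + Nat.card H.edgeSet ≤ n + Nat.card G.edgeSet

open SimpleGraph
namespace NC2
open Equiv Equiv.Perm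
set_option linter.unusedSectionVars false

/-- number of classes -/
noncomputable def Z {D : Type*} (s : Setoid D) : ℕ := Nat.card (Quotient s)

/-- merge the classes of a and b -/
def Mg {D : Type*} (s : Setoid D) (a b : D) : Setoid D where
  r x y := s x y ∨ (s x a ∨ s x b) ∧ (s y a ∨ s y b)
  iseqv := by
    refine ⟨fun x => Or.inl (s.refl x), ?_, ?_⟩
    · rintro x y (h | h)
      · exact Or.inl (s.symm h)
      · exact Or.inr ⟨h.2, h.1⟩
    · rintro x y z (h | h) (h' | h')
      · exact Or.inl (s.trans h h')
      · exact Or.inr ⟨h'.1.imp (s.trans h) (s.trans h), h'.2⟩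
      · exact Or.inr ⟨h.1, h.2.imp (s.trans (s.symm h')) (s.trans (s.symm h'))⟩
      · exact Or.inr ⟨h.1, h'.2⟩

lemma Mg_apply {D : Type*} (s : Setoid D) (a b x y : D) :
    (Mg s a b) x y ↔ s x y ∨ (s x a ∨ s x b) ∧ (s y a ∨ s y b) := Iff.rfl

lemma Mg_eq {D : Type*} (s : Setoid D) {a b : D} (h : s a b) : Mg s a b = s := by
  ext x y
  rw [Mg_apply]
  constructor
  · rintro (h' | ⟨h1, h2⟩)
    · exact h'
    · have e1 : s x a := h1.elim id (fun q => s.trans q (s.symm h))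
      have e2 : s y a := h2.elim id (fun q => s.trans q (s.symm h))
      exact s.trans e1 (s.symm e2)
  · exact Or.inl

lemma Z_Mg {D : Type*} [Finite D] (s : Setoid D) {a b : D} (h : ¬ s a b) :
    Z s = Z (Mg s a b) + 1 := by
  classical
  unfold Z
  have hle : s ≤ Mg s a b := fun {x y} h => Or.inl h
  let f : {q : Quotient s // q ≠ Quotient.mk s b} → Quotient (Mg s a b) := fun q =>
    Quotient.map' id (fun x y h => hle h) q.1
  have hf : Function.Bijective f := by
    constructor
    · rintro ⟨q, hq⟩ ⟨q', hq'⟩ hh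
      induction q using Quotient.inductionOn with | h x => ?_
      induction q' using Quotient.inductionOn with | h y => ?_
      have h1 : (Mg s a b) x y := Quotient.exact hh
      have hx : ¬ s x b := fun h => hq (Quotient.sound h)
      have hy : ¬ s y b := fun h => hq' (Quotient.sound h)
      have : s x y := by
        rcases h1 with h1 | ⟨h1 | h1, h2 | h2⟩
        · exact h1
        · exact s.trans h1 (s.symm h2)
        · exact absurd h2 hy
        · exact absurd h1 hx
        · exact absurd h2 hy
      exact Subtype.ext (Quotient.sound this)
    · intro q
      induction q using Quotient.inductionOn with | h x => ?_
      by_cases hx : s x b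
      · refine ⟨⟨Quotient.mk s a, fun h' => h (Quotient.exact h')⟩, ?_⟩
        exact Quotient.sound (s := Mg s a b) (Or.inr ⟨Or.inl (s.refl a), Or.inr hx⟩)
      · exact ⟨⟨Quotient.mk s x, fun h' => hx (Quotient.exact h')⟩, rfl⟩
  rw [← Nat.card_eq_of_bijective f hf]
  have := Fintype.ofFinite (Quotient s)
  rw [Nat.card_eq_fintype_card, Nat.card_eq_fintype_card]
  have h2 := Fintype.card_subtype_compl (fun q : Quotient s => q = Quotient.mk s b)
  rw [Fintype.card_subtype_eq] at h2
  have h3 : 0 < Fintype.card (Quotient s) := Fintype.card_pos_iff.2 ⟨Quotient.mk s b⟩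
  have h4 : Fintype.card {q : Quotient s // q ≠ Quotient.mk s b} = Fintype.card {q : Quotient s // ¬ q = Quotient.mk s b} := rfl
  omega

/-- orbits of a permutation -/
def S {D : Type*} (π : Perm D) : Setoid D := SameCycle.setoid π

lemma S_apply {D : Type*} (π : Perm D) (x y : D) : (S π) x y ↔ SameCycle π x y := Iff.rfl

lemma S_step {D : Type*} (π : Perm D) (x : D) : (S π) x (π x) := ⟨1, by simp⟩

lemma S_le {D : Type*} (π : Perm D) (T : Setoid D) (h : ∀ x, T x (π x)) : S π ≤ T := by
  have key : ∀ (n : ℕ) x, T x ((π ^ n) x) := by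
    intro n
    induction n with
    | zero => intro x; exact T.refl x
    | succ k ih => intro x; rw [pow_succ']; exact T.trans (ih x) (h _)
  rintro x y ⟨i, rfl⟩
  obtain ⟨n, rfl | rfl⟩ := i.eq_nat_or_neg
  · exact key n x
  · have := key n ((π ^ (-(n : ℤ))) x)
    refine T.symm ?_
    have e : (π ^ n) ((π ^ (-(n : ℤ))) x) = x := by simp
    rwa [e] at this

/-- joint orbits -/
def C {D : Type*} (σ α : Perm D) : Setoid D := S σ ⊔ S α

lemma C_left {D : Type*} (σ α : Perm D) (x : D) : (C σ α) x (σ x) :=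
  (le_sup_left : S σ ≤ C σ α) (S_step σ x)

lemma C_right {D : Type*} (σ α : Perm D) (x : D) : (C σ α) x (α x) :=
  (le_sup_right : S α ≤ C σ α) (S_step α x)

lemma C_le {D : Type*} (σ α : Perm D) (T : Setoid D) (h : ∀ x, T x (σ x))
    (h' : ∀ x, T x (α x)) : C σ α ≤ T := sup_le (S_le _ _ h) (S_le _ _ h')

variable {D : Type*} [DecidableEq D]

lemma Mg_swap (s : Setoid D) (a b x : D) : (Mg s a b) x (swap a b x) := by
  by_cases h1 : x = a
  · subst h1; rw [swap_apply_left]; exact Or.inr ⟨Or.inl (s.refl _), Or.inr (s.refl _)⟩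
  · by_cases h2 : x = b
    · subst h2; rw [swap_apply_right]; exact Or.inr ⟨Or.inr (s.refl _), Or.inl (s.refl _)⟩
    · rw [swap_apply_of_ne_of_ne h1 h2]

lemma Mg_le {s T : Setoid D} {a b : D} (h : s ≤ T) (hab : T a b) : Mg s a b ≤ T := by
  rintro x y (h' | ⟨h1, h2⟩)
  · exact h h'
  · have e1 : T x a := h1.elim (fun q => h q) (fun q => T.trans (h q) (T.symm hab))
    have e2 : T y a := h2.elim (fun q => h q) (fun q => T.trans (h q) (T.symm hab))
    exact T.trans e1 (T.symm e2)

lemma Mg_ab (s : Setoid D) (a b : D) : (Mg s a b) a b :=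
  Or.inr ⟨Or.inl (s.refl _), Or.inr (s.refl _)⟩

lemma MgC_le (σ α : Perm D) (a b : D) :
    Mg (C σ α) a b ≤ Mg (C (swap a b * σ) α) a b := by
  refine Mg_le (C_le _ _ _ ?_ ?_) (Mg_ab _ _ _)
  · intro x
    have h1 : (Mg (C (swap a b * σ) α) a b) x ((swap a b * σ) x) := Or.inl (C_left _ _ _)
    have h2 := Mg_swap (C (swap a b * σ) α) a b ((swap a b * σ) x)
    have := Setoid.trans' _ h1 h2
    simpa using this
  · intro x; exact Or.inl (C_right _ _ _)

lemma MgC (σ α : Perm D) (a b : D) :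
    Mg (C (swap a b * σ) α) a b = Mg (C σ α) a b := by
  apply le_antisymm
  · have := MgC_le (swap a b * σ) α a b
    rwa [swap_mul_self_mul] at this
  · exact MgC_le σ α a b

lemma C_self (σ : Perm D) : C σ σ = S σ := sup_idem _

lemma C_one (σ : Perm D) : C 1 σ = S σ :=
  le_antisymm (C_le _ _ _ (fun x => (S σ).refl x) (S_step σ)) le_sup_right

lemma C_one' (σ : Perm D) : C σ 1 = S σ :=
  le_antisymm (C_le _ _ _ (S_step σ) (fun x => (S σ).refl x)) le_sup_left

lemma MgS (σ : Perm D) (a b : D) : Mg (S (swap a b * σ)) a b = Mg (S σ) a b := by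
  rw [← C_one', ← C_one', MgC]

lemma swap_join [Finite D] (π : Perm D) {a b : D} (h : ¬ (S π) a b) :
    (S (swap a b * π)) a b := by
  classical
  have ex : ∃ n, 0 < n ∧ (π ^ n) a = a := ⟨orderOf π, orderOf_pos π, by simp [pow_orderOf_eq_one]⟩
  obtain ⟨hn, hna⟩ := Nat.find_spec ex
  have hmin : ∀ m, m < Nat.find ex → 0 < m → (π ^ m) a ≠ a := fun m hm h0 h1 =>
    Nat.find_min ex hm ⟨h0, h1⟩
  generalize Nat.find ex = n at *
  have hb : ∀ m : ℕ, (π ^ m) a ≠ b := fun m hm => h ⟨m, by simpa using hm⟩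
  have key : ∀ k, k < n → ((swap a b * π) ^ k) a = (π ^ k) a := by
    intro k
    induction k with
    | zero => simp
    | succ k ih =>
      intro hk
      rw [pow_succ', Perm.mul_apply, ih (by omega), pow_succ', Perm.mul_apply, Perm.mul_apply]
      have e : π ((π ^ k) a) = (π ^ (k+1)) a := by rw [pow_succ', Perm.mul_apply]
      rw [e]
      exact swap_apply_of_ne_of_ne (hmin _ hk (by omega)) (hb _)
  refine ⟨n, ?_⟩
  obtain ⟨k, rfl⟩ : ∃ k, n = k + 1 := ⟨n - 1, by omega⟩
  rw [zpow_natCast, pow_succ', Perm.mul_apply, key k (by omega), Perm.mul_apply]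
  have e : π ((π ^ k) a) = (π ^ (k+1)) a := by rw [pow_succ', Perm.mul_apply]
  rw [e, hna, swap_apply_left]

lemma swap_split [Finite D] (π : Perm D) {a b : D} (hab : a ≠ b) (h : (S π) a b) :
    ¬ (S (swap a b * π)) a b := by
  classical
  have ex : ∃ n, (π ^ n) a = b := SameCycle.exists_nat_pow_eq h
  have hna := Nat.find_spec ex
  have hmin : ∀ m, m < Nat.find ex → (π ^ m) a ≠ b := fun m hm h1 => Nat.find_min ex hm h1
  generalize Nat.find ex = n at *
  have hn : 0 < n := by
    rcases Nat.eq_zero_or_pos n with rfl | h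
    · exact absurd (by simpa using hna) hab
    · exact h
  have ha : ∀ m, m < n → 0 < m → (π ^ m) a ≠ a := by
    intro m hm h0 h1
    apply hmin (n - m) (by omega)
    have : (π ^ (n - m)) ((π ^ m) a) = b := by
      rw [← Perm.mul_apply, ← pow_add, Nat.sub_add_cancel hm.le, hna]
    rwa [h1] at this
  have key : ∀ k, k < n → ((swap a b * π) ^ k) a = (π ^ k) a := by
    intro k
    induction k with
    | zero => simp
    | succ k ih =>
      intro hk
      rw [pow_succ', Perm.mul_apply, ih (by omega), pow_succ', Perm.mul_apply, Perm.mul_apply]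
      have e : π ((π ^ k) a) = (π ^ (k+1)) a := by rw [pow_succ', Perm.mul_apply]
      rw [e]
      exact swap_apply_of_ne_of_ne (ha _ hk (by omega)) (hmin _ hk)
  have per : ((swap a b * π) ^ n) a = a := by
    obtain ⟨k, rfl⟩ : ∃ k, n = k + 1 := ⟨n - 1, by omega⟩
    rw [pow_succ', Perm.mul_apply, key k (by omega), Perm.mul_apply]
    have e : π ((π ^ k) a) = (π ^ (k+1)) a := by rw [pow_succ', Perm.mul_apply]
    rw [e, hna, swap_apply_right]
  have per' : ∀ q, (((swap a b * π) ^ n) ^ q) a = a := by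
    intro q
    induction q with
    | zero => simp
    | succ q ih => rw [pow_succ', Perm.mul_apply, ih, per]
  intro hS
  obtain ⟨k, hk⟩ := SameCycle.exists_nat_pow_eq hS
  have : ((swap a b * π) ^ k) a = (π ^ (k % n)) a := by
    conv_lhs => rw [← Nat.mod_add_div k n, pow_add, pow_mul, Perm.mul_apply, per']
    exact key _ (Nat.mod_lt _ hn)
  exact hmin (k % n) (Nat.mod_lt _ hn) (by rw [← this, hk])

/-- Euler defect -/
noncomputable def df (σ α : Perm D) : ℤ :=
  Nat.card D + 2 * Z (C σ α) - Z (S σ) - Z (S α) - Z (S (σ * α))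

lemma Z_split [Finite D] (σ : Perm D) {a b : D} (hab : a ≠ b) (h : (S σ) a b) :
    Z (S (swap a b * σ)) = Z (S σ) + 1 := by
  rw [Z_Mg _ (swap_split σ hab h), MgS, Mg_eq _ h]

lemma df_split [Finite D] (σ α : Perm D) {a b : D} (hab : a ≠ b) (h : (S σ) a b) :
    df (swap a b * σ) α ≤ df σ α := by
  unfold df
  have h1 := Z_split σ hab h
  have hC : (C σ α) a b := (le_sup_left : S σ ≤ C σ α) h
  have hM := MgC σ α a b
  rw [Mg_eq _ hC] at hM
  by_cases h2 : (S (σ * α)) a b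
  · have h3 := Z_split (σ * α) hab h2
    rw [← mul_assoc] at h3
    by_cases h4 : (C (swap a b * σ) α) a b
    · rw [Mg_eq _ h4] at hM
      rw [hM]; omega
    · have := Z_Mg _ h4
      rw [hM] at this
      omega
  · have h3 := swap_join (σ * α) h2
    rw [← mul_assoc] at h3
    have h5 := MgS (σ * α) a b
    rw [← mul_assoc, Mg_eq _ h3] at h5
    have h6 := Z_Mg _ h2
    rw [← h5] at h6
    have h4 : (C (swap a b * σ) α) a b := by
      refine S_le _ _ ?_ h3
      intro x
      exact Setoid.trans' _ (C_right (swap a b * σ) α x) (C_left _ _ _)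
    rw [Mg_eq _ h4] at hM
    rw [hM]; omega

lemma df_nonneg [Fintype D] (α : Perm D) : ∀ (n : ℕ) (σ : Perm D), σ.support.card ≤ n → 0 ≤ df σ α := by
  intro n
  induction n with
  | zero =>
    intro σ h
    have : σ = 1 := by
      rw [← Perm.support_eq_empty_iff]; exact Finset.card_eq_zero.1 (by omega)
    subst this
    unfold df
    have e : Z (S (1 : Perm D)) = Nat.card D := by
      unfold Z
      symm
      refine Nat.card_eq_of_bijective (Quotient.mk (S (1 : Perm D))) ⟨?_, Quotient.mk_surjective⟩
      intro x y hxy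
      have : SameCycle 1 x y := Quotient.exact hxy
      simpa using this
    rw [e, C_one, one_mul]
    omega
  | succ n ih =>
    intro σ h
    by_cases h1 : σ = 1
    · subst h1; exact ih 1 (by simp)
    · obtain ⟨a, ha⟩ : ∃ a, σ a ≠ a := by
        by_contra hh; push Not at hh; exact h1 (Perm.ext hh)
      have := Perm.card_support_swap_mul ha
      exact (ih _ (by omega)).trans (df_split σ α (Ne.symm ha) (S_step σ a))

lemma df_zero [Fintype D] (σ α : Perm D) {a : D} (ha : σ a ≠ a) (h : df σ α = 0) :
    df (swap a (σ a) * σ) α = 0 :=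
  le_antisymm (h ▸ df_split σ α (Ne.symm ha) (S_step σ a)) (df_nonneg α _ _ le_rfl)

lemma rm_same (σ : Perm D) {d x y : D} (h : (S σ) x y) (hx : x ≠ d) (hy : y ≠ d)
    (hd : σ d ≠ d) : (S (swap d (σ d) * σ)) x y := by
  set τ := swap d (σ d) * σ with hτ
  let r : D → D := fun x => if x = d then σ d else x
  have key : S σ ≤ Setoid.comap r (S τ) := by
    apply S_le
    intro z
    show (S τ) (r z) (r (σ z))
    by_cases hz : z = d
    · subst hz
      have : r z = r (σ z) := by simp [r]
      rw [this]
    · by_cases h2 : σ z = d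
      · have e : r (σ z) = τ (r z) := by simp [r, hz, h2, hτ]
        rw [e]; exact S_step _ _
      · have e : r (σ z) = τ (r z) := by
          have : σ z ≠ σ d := fun h => hz (σ.injective h)
          simp [r, hz, h2, hτ, swap_apply_of_ne_of_ne h2 this]
        rw [e]; exact S_step _ _
  have : (S τ) (r x) (r y) := key h
  simpa [r, hx, hy] using this

lemma Z_ext {D' : Type*} [Finite D] [Finite D'] (σ α : Perm D) (σ' α' : Perm D') (ι : D' → D)
    (hι : Function.Injective ι)
    (h1 : ∀ x, ι (σ' x) = σ (ι x)) (h2 : ∀ x, ι (α' x) = α (ι x)) (d : D) (hd : d ∉ Set.range ι)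
    (hr : ∀ x, x ∉ Set.range ι → (C σ α) x d) : Z (C σ α) = Z (C σ' α') + 1 := by
  classical
  let T : Setoid D :=
    { r := fun x y => (∃ x' y', ι x' = x ∧ ι y' = y ∧ (C σ' α') x' y') ∨
        (x ∉ Set.range ι ∧ y ∉ Set.range ι)
      iseqv := by
        refine ⟨?_, ?_, ?_⟩
        · intro x
          by_cases h : x ∈ Set.range ι
          · obtain ⟨x', rfl⟩ := h
            exact Or.inl ⟨x', x', rfl, rfl, Setoid.refl' _ _⟩
          · exact Or.inr ⟨h, h⟩
        · rintro x y (⟨x', y', rfl, rfl, h⟩ | h)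
          · exact Or.inl ⟨y', x', rfl, rfl, Setoid.symm' _ h⟩
          · exact Or.inr ⟨h.2, h.1⟩
        · rintro x y z (⟨x', y', rfl, rfl, h⟩ | h) (⟨y'', z', h3, rfl, h'⟩ | h')
          · have := hι h3
            subst this
            exact Or.inl ⟨x', z', rfl, rfl, Setoid.trans' _ h h'⟩
          · exact absurd ⟨_, rfl⟩ h'.1
          · exact absurd ⟨_, h3⟩ h.2
          · exact Or.inr ⟨h.1, h'.2⟩ }
  have inv : ∀ (π : Perm D) (π' : Perm D') , (∀ x, ι (π' x) = π (ι x)) → ∀ x, x ∉ Set.range ι →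
      π x ∉ Set.range ι := by
    rintro π π' h x hx ⟨y, hy⟩
    apply hx
    refine ⟨π'.symm y, ?_⟩
    apply π.injective
    rw [← h, ← hy]; simp
  have hT : C σ α ≤ T := by
    apply C_le
    · intro x
      by_cases h : x ∈ Set.range ι
      · obtain ⟨x', rfl⟩ := h
        exact Or.inl ⟨x', σ' x', rfl, h1 _, C_left _ _ _⟩
      · exact Or.inr ⟨h, inv _ _ h1 x h⟩
    · intro x
      by_cases h : x ∈ Set.range ι
      · obtain ⟨x', rfl⟩ := h
        exact Or.inl ⟨x', α' x', rfl, h2 _, C_right _ _ _⟩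
      · exact Or.inr ⟨h, inv _ _ h2 x h⟩
  have hc : C σ' α' ≤ Setoid.comap ι (C σ α) := by
    apply C_le
    · intro x; show (C σ α) _ _; rw [h1]; exact C_left _ _ _
    · intro x; show (C σ α) _ _; rw [h2]; exact C_right _ _ _
  let f : Option (Quotient (C σ' α')) → Quotient (C σ α) := fun o =>
    o.elim (Quotient.mk _ d) (Quotient.map' ι (fun x y h => hc h))
  have hf : Function.Bijective f := by
    constructor
    · intro o o' hh
      have nd : ∀ x, ¬ (C σ α) d (ι x) := by
        intro x hx
        rcases hT hx with ⟨x', y', h, _⟩ | h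
        · exact hd ⟨_, h⟩
        · exact h.2 ⟨_, rfl⟩
      rcases o with _ | q <;> rcases o' with _ | q'
      · rfl
      · induction q' using Quotient.inductionOn with | h y => ?_
        exact absurd (Quotient.exact hh) (nd y)
      · induction q using Quotient.inductionOn with | h y => ?_
        exact absurd (Quotient.exact hh.symm) (nd y)
      · induction q' using Quotient.inductionOn with | h y => ?_
        induction q using Quotient.inductionOn with | h x => ?_
        have h3 : (C σ α) (ι x) (ι y) := Quotient.exact hh
        rcases hT h3 with ⟨x', y', e1, e2, h⟩ | h
        · rw [← hι e1, ← hι e2]; exact congrArg some (Quotient.sound h)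
        · exact absurd ⟨_, rfl⟩ h.1
    · intro q
      induction q using Quotient.inductionOn with | h x => ?_
      by_cases h : x ∈ Set.range ι
      · obtain ⟨x', rfl⟩ := h
        exact ⟨some (Quotient.mk _ x'), rfl⟩
      · exact ⟨none, Quotient.sound (Setoid.symm' _ (hr x h))⟩
  unfold Z
  rw [← Nat.card_eq_of_bijective f hf, Finite.card_option]

end NC2

open SimpleGraph
namespace NC2
set_option linter.unusedSectionVars false
open Equiv Equiv.Perm

lemma Z_of_map {D X : Type*} (s : Setoid D) (f : D → X) (h : ∀ x y, f x = f y ↔ s x y) :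
    Z s = (Set.range f).ncard := by
  have : s = Setoid.ker f := by
    ext x y; rw [Setoid.ker_def]; exact (h x y).symm
  subst this
  unfold Z
  rw [← Nat.card_coe_set_eq]
  exact Nat.card_congr (Setoid.quotientKerEquivRange f)

section
variable {V : Type*} [Fintype V] {G : SimpleGraph V} (R : RotationSystem G)

instance : Finite G.Dart := Finite.of_injective _ (Dart.toProd_injective (G := G))

lemma Z_sigma : Z (S R.σ) = (Set.range (fun d : G.Dart => d.fst)).ncard := by
  apply Z_of_map
  intro x y
  constructor
  · exact R.vertex_cycles x y
  · intro h
    have : S R.σ ≤ Setoid.ker (fun d : G.Dart => d.fst) :=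
      S_le _ _ (fun x => (R.tail_fixed x).symm)
    exact this h

lemma Z_alpha : Z (S (dartRev G)) = Nat.card G.edgeSet := by
  rw [Z_of_map (S (dartRev G)) (fun d => d.edge)]
  · rw [Nat.card_coe_set_eq]
    congr 1
    ext e
    constructor
    · rintro ⟨d, rfl⟩; exact d.edge_mem
    · intro h
      induction e with | h a b => exact ⟨⟨(a, b), h⟩, rfl⟩
  · intro x y
    constructor
    · intro h
      rcases (dart_edge_eq_iff x y).1 h with rfl | rfl
      · exact Setoid.refl' _ _
      · exact Setoid.symm' _ (S_step (dartRev G) y)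
    · intro h
      have : S (dartRev G) ≤ Setoid.ker (fun d : G.Dart => d.edge) :=
        S_le _ _ (fun x => (Dart.edge_symm x).symm)
      exact this h

lemma Z_comp : Z (C R.σ (dartRev G)) =
    (Set.range (fun d : G.Dart => G.connectedComponentMk d.fst)).ncard := by
  apply Z_of_map
  intro x y
  constructor
  · intro h
    obtain ⟨p⟩ := ConnectedComponent.exact h
    have key : ∀ (a b : V) (p : G.Walk a b) (x y : G.Dart), x.fst = a → y.fst = b →
        (C R.σ (dartRev G)) x y := by
      intro a b p
      induction p with
      | nil =>
        intro x y hx hy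
        exact (le_sup_left : S R.σ ≤ C R.σ (dartRev G)) (R.vertex_cycles x y (hx.trans hy.symm))
      | @cons a b' c h p ih =>
        intro x y hx hy
        let e : G.Dart := ⟨(a, b'), h⟩
        have h1 : (C R.σ (dartRev G)) x e :=
          (le_sup_left : S R.σ ≤ C R.σ (dartRev G)) (R.vertex_cycles x e hx)
        have h2 : (C R.σ (dartRev G)) e (dartRev G e) := C_right _ _ _
        exact Setoid.trans' _ (Setoid.trans' _ h1 h2) (ih _ y rfl hy)
    exact key _ _ p x y rfl rfl
  · intro h
    have : C R.σ (dartRev G) ≤ Setoid.ker (fun d : G.Dart => G.connectedComponentMk d.fst) := by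
      apply C_le
      · intro x
        show G.connectedComponentMk x.fst = G.connectedComponentMk (R.σ x).fst
        rw [R.tail_fixed]
      · intro x
        exact ConnectedComponent.sound (x.adj.reachable)
    exact this h

lemma card_dart : Nat.card G.Dart = 2 * Nat.card G.edgeSet := by
  classical
  rw [Nat.card_eq_fintype_card, Nat.card_eq_fintype_card, dart_card_eq_twice_card_edges,
    edgeFinset_card]

lemma df_eq : df R.σ (dartRev G) = Nat.card G.edgeSet +
    2 * (Set.range (fun d : G.Dart => G.connectedComponentMk d.fst)).ncard
    - (Set.range (fun d : G.Dart => d.fst)).ncard - R.numFaces := by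
  unfold df
  rw [Z_sigma, Z_comp, Z_alpha, card_dart]
  have : Z (S (R.σ * dartRev G)) = R.numFaces := rfl
  rw [this]
  push_cast
  ring

lemma planar_no_isolated (h : R.IsPlanarEmbedding) : ∀ v, ∃ w, G.Adj v w := by
  classical
  have h0 : 0 ≤ df R.σ (dartRev G) := by
    have := Fintype.ofFinite G.Dart
    exact df_nonneg _ _ _ le_rfl
  rw [df_eq] at h0
  unfold RotationSystem.IsPlanarEmbedding at h
  set N := Set.range (fun d : G.Dart => d.fst) with hN
  set K := Set.range (fun d : G.Dart => G.connectedComponentMk d.fst) with hK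
  have e1 := Set.ncard_add_ncard_compl N
  have e2 := Set.ncard_add_ncard_compl K
  rw [Nat.card_eq_fintype_card] at e1
  have memN : ∀ v w, G.Adj v w → v ∈ N := fun v w h => ⟨⟨(v, w), h⟩, rfl⟩
  have iso : ∀ v ∉ N, ∀ w, G.Reachable v w → v = w := by
    rintro v hv w ⟨p⟩
    cases p with
    | nil => rfl
    | cons h p => exact absurd (memN _ _ h) hv
  have e3 : Nᶜ.ncard ≤ Kᶜ.ncard := by
    refine Set.ncard_le_ncard_of_injOn G.connectedComponentMk ?_ ?_
    · rintro v hv ⟨d, hd⟩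
      have := iso v hv d.fst (ConnectedComponent.exact hd.symm)
      exact hv ⟨d, this.symm⟩
    · intro v hv w hw hvw
      exact iso v hv w (ConnectedComponent.exact hvw)
  have e4 : Nᶜ.ncard = 0 := by omega
  intro v
  have : v ∈ N := by
    by_contra hv
    have : Nᶜ = ∅ := (Set.ncard_eq_zero (Set.toFinite _)).1 e4
    have h5 : v ∈ Nᶜ := hv
    rw [this] at h5
    exact h5
  obtain ⟨d, rfl⟩ := this
  exact ⟨d.snd, d.adj⟩

lemma df_iff (hi : ∀ v, ∃ w, G.Adj v w) : R.IsPlanarEmbedding ↔ df R.σ (dartRev G) = 0 := by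
  rw [df_eq]
  have h1 : Set.range (fun d : G.Dart => d.fst) = Set.univ := by
    ext v; obtain ⟨w, h⟩ := hi v
    simp only [Set.mem_univ, iff_true]
    exact ⟨⟨(v, w), h⟩, rfl⟩
  have h2 : Set.range (fun d : G.Dart => G.connectedComponentMk d.fst) = Set.univ := by
    ext c
    induction c using ConnectedComponent.ind with | h v => ?_
    obtain ⟨w, h⟩ := hi v
    simp only [Set.mem_univ, iff_true]
    exact ⟨⟨(v, w), h⟩, rfl⟩
  rw [h1, h2, Set.ncard_univ, Set.ncard_univ]
  unfold RotationSystem.IsPlanarEmbedding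
  rw [Nat.card_eq_fintype_card (α := V)]
  omega

end

section
variable {V W : Type*} [Fintype V] [Fintype W] {G : SimpleGraph V} {G' : SimpleGraph W} (e : W ≃ V)

theorem planar_delete (u w : V) (huw : G.Adj u w)
    (hG' : ∀ a b, G'.Adj a b ↔ G.Adj (e a) (e b) ∧ s(e a, e b) ≠ s(u, w))
    (hi' : ∀ v, ∃ w, G'.Adj v w) (hp : IsPlanar G) : IsPlanar G' := by
  classical
  obtain ⟨R, hR⟩ := hp
  have hi := planar_no_isolated R hR
  have hdf := (df_iff R hi).1 hR
  have := Fintype.ofFinite G.Dart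
  let d : G.Dart := ⟨(u, w), huw⟩
  let d' : G.Dart := d.symm
  have hdd : d'.fst ≠ d.fst := huw.ne.symm
  -- each endpoint has another dart
  have other : ∀ z : G.Dart, z.edge = s(u, w) → R.σ z ≠ z := by
    intro z hz hfix
    obtain ⟨b, hb⟩ := hi' (e.symm z.fst)
    rw [hG', e.apply_symm_apply] at hb
    let t : G.Dart := ⟨(z.fst, e b), hb.1⟩
    obtain ⟨i, hi⟩ := R.vertex_cycles z t rfl
    have : ((R.σ ^ i) z) = z := Perm.zpow_apply_eq_self_of_apply_eq_self hfix i
    rw [this] at hi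
    apply hb.2
    rw [← hz, hi]
    rfl
  have hd1 : R.σ d ≠ d := other d rfl
  have hd2 : R.σ d' ≠ d' := other d' (Dart.edge_symm d)
  set σ1 := swap d (R.σ d) * R.σ with hσ1
  have hσ1d' : σ1 d' = R.σ d' := by
    rw [hσ1, Perm.mul_apply]
    apply swap_apply_of_ne_of_ne
    · intro h; apply hdd; rw [← h, R.tail_fixed]
    · intro h; apply hdd; rw [R.σ.injective h]
  have hd3 : σ1 d' ≠ d' := by rw [hσ1d']; exact hd2
  set σ2 := swap d' (σ1 d') * σ1 with hσ2
  have df2 : df σ2 (dartRev G) = 0 := df_zero _ _ hd3 (df_zero _ _ hd1 hdf)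
  have zσ2 : Z (S σ2) = Fintype.card V + 2 := by
    rw [hσ2, Z_split σ1 hd3.symm (S_step _ _), hσ1, Z_split R.σ hd1.symm (S_step _ _), Z_sigma]
    have h1 : Set.range (fun d : G.Dart => d.fst) = Set.univ := by
      ext v; obtain ⟨w, h⟩ := hi v
      simp only [Set.mem_univ, iff_true]
      exact ⟨⟨(v, w), h⟩, rfl⟩
    rw [h1, Set.ncard_univ, Nat.card_eq_fintype_card]
  have fix1 : σ1 d = d := by simp [hσ1]
  have fix2 : σ2 d' = d' := by simp [hσ2]
  have fix3 : σ2 d = d := by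
    rw [hσ2, Perm.mul_apply, fix1]
    apply swap_apply_of_ne_of_ne
    · intro h; exact hdd (by rw [← h])
    · intro h; rw [hσ1d'] at h; apply hdd; rw [← R.tail_fixed d', ← h]
  have tail1 : ∀ x, (σ1 x).fst = x.fst := by
    intro x
    rw [hσ1, Perm.mul_apply, swap_apply_def]
    split_ifs with h1 h2
    · rw [R.tail_fixed, ← h1, R.tail_fixed]
    · rw [← R.tail_fixed d, ← h2, R.tail_fixed]
    · exact R.tail_fixed x
  have tail2 : ∀ x, (σ2 x).fst = x.fst := by
    intro x
    rw [hσ2, Perm.mul_apply, swap_apply_def]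
    split_ifs with h1 h2
    · rw [tail1, ← h1, tail1]
    · rw [← tail1 d', ← h2, tail1]
    · exact tail1 x
  have vc : ∀ x y : G.Dart, x ≠ d → x ≠ d' → y ≠ d → y ≠ d' → x.fst = y.fst → (S σ2) x y := by
    intro x y h1 h2 h3 h4 h5
    exact rm_same σ1 (rm_same R.σ (R.vertex_cycles x y h5) h1 h3 hd1) h2 h4 hd3
  -- the embedding of darts
  let ι : G'.Dart → G.Dart := fun x => ⟨(e x.fst, e x.snd), ((hG' _ _).1 x.adj).1⟩
  have hι : Function.Injective ι := by
    intro x y h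
    apply Dart.ext
    have h1 : (ι x).fst = (ι y).fst := by rw [h]
    have h2 : (ι x).snd = (ι y).snd := by rw [h]
    exact Prod.ext (e.injective h1) (e.injective h2)
  have hrange : ∀ x : G.Dart, x ∈ Set.range ι ↔ (x ≠ d ∧ x ≠ d') := by
    intro x
    have hx : x.edge = s(u, w) ↔ (x = d ∨ x = d') := dart_edge_eq_iff x d
    rw [← not_or, ← hx]
    constructor
    · rintro ⟨x', rfl⟩
      exact ((hG' _ _).1 x'.adj).2
    · intro h
      refine ⟨⟨(e.symm x.fst, e.symm x.snd), (hG' _ _).2 ?_⟩, ?_⟩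
      · rw [e.apply_symm_apply, e.apply_symm_apply]; exact ⟨x.adj, h⟩
      · apply Dart.ext
        exact Prod.ext (e.apply_symm_apply _) (e.apply_symm_apply _)
  have invσ : ∀ x, x ∈ Set.range ι ↔ σ2 x ∈ Set.range ι := by
    intro x
    rw [hrange, hrange]
    have e1 : σ2 x = d ↔ x = d := by
      conv_lhs => rw [← fix3]
      exact σ2.injective.eq_iff
    have e2 : σ2 x = d' ↔ x = d' := by
      conv_lhs => rw [← fix2]
      exact σ2.injective.eq_iff
    rw [ne_eq, ne_eq, ne_eq, ne_eq, e1, e2]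
  let E : G'.Dart ≃ Set.range ι := Equiv.ofInjective ι hι
  let σ' : Perm G'.Dart := E.symm.permCongr (σ2.subtypePerm (p := fun x => x ∈ Set.range ι) (fun x => (invσ x).symm))
  have hσ' : ∀ x, ι (σ' x) = σ2 (ι x) := by
    intro x
    have : ∀ z : Set.range ι, ι (E.symm z) = z := fun z => by
      exact Equiv.apply_ofInjective_symm hι z
    show ι (E.symm _) = _
    rw [this]
    rfl
  have hsame : ∀ x y : G'.Dart, (S σ2) (ι x) (ι y) → SameCycle σ' x y := by
    rintro x y ⟨i, hi⟩
    refine ⟨i, hι ?_⟩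
    rw [← hi]
    have key : ∀ (n : ℕ) z, ι ((σ' ^ n) z) = (σ2 ^ n) (ι z) := by
      intro n
      induction n with
      | zero => intro z; rfl
      | succ k ih => intro z; rw [pow_succ', Perm.mul_apply, hσ', ih, pow_succ']; rfl
    obtain ⟨n, rfl | rfl⟩ := i.eq_nat_or_neg
    · exact key n x
    · have := key n ((σ' ^ (-(n : ℤ))) x)
      apply (σ2 ^ n).injective
      rw [← this]; simp
  let R' : RotationSystem G' :=
    { σ := σ'
      tail_fixed := fun x => by
        have h1 := tail2 (ι x)
        rw [← hσ'] at h1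
        exact e.injective h1
      vertex_cycles := fun x y h => by
        apply hsame
        have hx := (hrange (ι x)).1 ⟨x, rfl⟩
        have hy := (hrange (ι y)).1 ⟨y, rfl⟩
        exact vc _ _ hx.1 hx.2 hy.1 hy.2 (congrArg e h) }
  refine ⟨R', (df_iff R' hi').2 ?_⟩
  have hα : ∀ x, ι (dartRev G' x) = dartRev G (ι x) := fun x => rfl
  have hφ : ∀ x, ι ((σ' * dartRev G') x) = (σ2 * dartRev G) (ι x) := by
    intro x
    rw [Perm.mul_apply, hσ', hα]; rfl
  have hdr : d ∉ Set.range ι := by rw [hrange]; tauto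
  have hout : ∀ x, x ∉ Set.range ι → x = d ∨ x = d' := by
    intro x hx; rw [hrange] at hx; tauto
  have z1 := Z_ext σ2 (dartRev G) σ' (dartRev G') ι hι hσ' hα d hdr (by
    intro x hx
    rcases hout x hx with rfl | rfl
    · exact Setoid.refl' _ _
    · exact Setoid.symm' _ (C_right _ _ d))
  have z2 := Z_ext (σ2 * dartRev G) (σ2 * dartRev G) (σ' * dartRev G') (σ' * dartRev G') ι hι hφ hφ d hdr (by
    intro x hx
    rcases hout x hx with rfl | rfl
    · exact Setoid.refl' _ _
    · have := C_left (σ2 * dartRev G) (σ2 * dartRev G) d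
      rw [Perm.mul_apply] at this
      have e9 : dartRev G d = d' := rfl
      rw [e9, fix2] at this
      exact Setoid.symm' _ this)
  rw [C_self, C_self] at z2
  have z3 : Z (S σ') = Fintype.card V := by
    have := Z_sigma R'
    rw [show R'.σ = σ' from rfl] at this
    rw [this]
    have h1 : Set.range (fun d : G'.Dart => d.fst) = Set.univ := by
      ext v; obtain ⟨w, h⟩ := hi' v
      simp only [Set.mem_univ, iff_true]
      exact ⟨⟨(v, w), h⟩, rfl⟩
    rw [h1, Set.ncard_univ, Nat.card_congr e, Nat.card_eq_fintype_card]
  have c1 : Nat.card G.Dart = Nat.card G'.Dart + 2 := by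
    have h1 := Set.ncard_add_ncard_compl (Set.range ι)
    have h2 : (Set.range ι)ᶜ = {d, d'} := by
      ext x
      rw [Set.mem_compl_iff, hrange]
      simp only [Set.mem_insert_iff, Set.mem_singleton_iff]
      tauto
    have h3 : d ≠ d' := fun h => hdd (by rw [← h])
    rw [h2, Set.ncard_pair h3] at h1
    rw [← h1, ← Nat.card_coe_set_eq, Nat.card_congr E]
  have c2 := card_dart (G := G)
  have c3 := card_dart (G := G')
  have a1 := Z_alpha (G := G)
  have a2 := Z_alpha (G := G')
  unfold df at df2 ⊢
  rw [show R'.σ = σ' from rfl]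
  omega

end
end NC2

open SimpleGraph
namespace NC2

lemma vdeg_le {V W : Type*} [Finite V] (G : SimpleGraph V) (G' : SimpleGraph W) (e : W ↪ V)
    (h : ∀ a b, G'.Adj a b → G.Adj (e a) (e b)) (a : W) : vdeg G' a ≤ vdeg G (e a) := by
  unfold vdeg
  refine Nat.card_le_card_of_injective
    (fun x : G'.neighborSet a => (⟨e x.1, h _ _ x.2⟩ : G.neighborSet (e a))) ?_
  intro x y hxy
  exact Subtype.ext (e.injective (congrArg Subtype.val hxy))

lemma edges_ne {V W : Type*} {G : SimpleGraph V} {G' : SimpleGraph W} (f : G' →g G)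
    (hf : Function.Injective f) {a : W} (c₁ c₂ : G'.Walk a a)
    (h : {e | e ∈ c₁.edges} ≠ {e | e ∈ c₂.edges}) :
    {e | e ∈ (c₁.map f).edges} ≠ {e | e ∈ (c₂.map f).edges} := by
  have key : ∀ c : G'.Walk a a, {e | e ∈ (c.map f).edges} = Sym2.map f '' {e | e ∈ c.edges} := by
    intro c
    ext e
    simp [Walk.edges_map]
  rw [key, key]
  intro h'
  exact h ((Sym2.map.injective hf).image_injective h')

lemma good_sub {V W : Type*} [Fintype V] [Fintype W] (G : SimpleGraph V) (G' : SimpleGraph W)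
    (f : G' →g G) (hf : Function.Injective f) (hG : GoodGraph G) (hp : IsPlanar G')
    (h6 : ∃ v, vdeg G' v = 6) : GoodGraph G' := by
  obtain ⟨_, ⟨hm, _⟩, hd, hh, hg⟩ := hG
  have hv : ∀ a, vdeg G' a ≤ vdeg G (f a) := vdeg_le G G' ⟨f, hf⟩ (fun a b h => f.map_adj h)
  refine ⟨hp, ⟨fun a => (hv a).trans (hm _), h6⟩, ?_, ?_, ?_⟩
  · rintro ⟨g, hg1, hg2⟩
    exact hd ⟨f ∘ g, hf.comp hg1, fun u v h => f.map_adj (hg2 h)⟩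
  · rintro ⟨g, hg1, hg2⟩
    exact hh ⟨f ∘ g, hf.comp hg1, fun u v h => f.map_adj (hg2 h)⟩
  · intro a ha
    have h6 : vdeg G (f a) = 6 := le_antisymm (hm _) (ha ▸ hv a)
    refine (hg (f a) h6).imp ?_ ?_
    · rintro hn ⟨c₁, c₂, h1, h2, h3, h4, h5, e, h6, h7⟩
      refine hn ⟨c₁.map f, c₂.map f, h1.map hf, h2.map hf, by simpa using h3, by simpa using h4,
        edges_ne f hf _ _ h5, Sym2.map f e, ?_, ?_⟩
      · rw [Walk.edges_map]; exact List.mem_map_of_mem h6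
      · rw [Walk.edges_map]; exact List.mem_map_of_mem h7
    · rintro hn p q l hpq ⟨c₁, c₂, c₃, h1, h2, h3, h4, h5, h6, h7, h8, h9⟩
      exact hn p q l hpq ⟨c₁.map f, c₂.map f, c₃.map f, h1.map hf, h2.map hf, h3.map hf,
        by simpa using h4, by simpa using h5, by simpa using h6,
        edges_ne f hf _ _ h7, edges_ne f hf _ _ h8, edges_ne f hf _ _ h9⟩

theorem delete_color {V : Type*} [Fintype V] (H : SimpleGraph V) (hmin : MinimalCounterexample H)
    (u w v u' w' : V) (huw : H.Adj u w) (hv : vdeg H v = 6) (hvu : v ≠ u) (hvw : v ≠ w)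
    (hu : H.Adj u u') (huw' : u' ≠ w) (hw : H.Adj w w') (hwu' : w' ≠ u) :
    ∃ (cv : V → Fin 7) (ce : Sym2 V → Fin 7),
      (∀ a b, H.Adj a b → s(a, b) ≠ s(u, w) → cv a ≠ cv b) ∧
      (∀ a b c, H.Adj a b → H.Adj a c → b ≠ c → s(a, b) ≠ s(u, w) → s(a, c) ≠ s(u, w) →
        ce s(a, b) ≠ ce s(a, c)) ∧
      (∀ a b, H.Adj a b → s(a, b) ≠ s(u, w) → ce s(a, b) ≠ cv a) := by
  classical
  obtain ⟨hgood, hnot, hm⟩ := hmin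
  let e : Fin (Fintype.card V) ≃ V := (Fintype.equivFin V).symm
  let G' : SimpleGraph (Fin (Fintype.card V)) :=
    { Adj := fun a b => H.Adj (e a) (e b) ∧ s(e a, e b) ≠ s(u, w)
      symm := ⟨fun a b h => ⟨h.1.symm, by rw [Sym2.eq_swap]; exact h.2⟩⟩
      loopless := ⟨fun a h => H.loopless.irrefl _ h.1⟩ }
  have hadj : ∀ a b, G'.Adj a b ↔ H.Adj (e a) (e b) ∧ s(e a, e b) ≠ s(u, w) := fun a b => Iff.rfl
  have hi : ∀ v, ∃ w, H.Adj v w := by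
    obtain ⟨R, hR⟩ := hgood.1
    exact planar_no_isolated R hR
  have hi' : ∀ a, ∃ b, G'.Adj a b := by
    intro a
    obtain ⟨b, hb⟩ : ∃ b, H.Adj (e a) b ∧ s(e a, b) ≠ s(u, w) := by
      by_cases h1 : e a = u
      · exact ⟨u', h1 ▸ hu, by rw [h1]; simp [huw', huw.ne]⟩
      · by_cases h2 : e a = w
        · exact ⟨w', h2 ▸ hw, by rw [h2]; simp [hwu', huw.ne.symm]⟩
        · obtain ⟨b, hb⟩ := hi (e a)
          exact ⟨b, hb, by simp [h1, h2]⟩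
    exact ⟨e.symm b, by rw [hadj]; simpa using hb⟩
  have hp : IsPlanar G' := planar_delete e u w huw hadj hi' hgood.1
  let f : G' →g H := ⟨e, fun h => h.1⟩
  have hgood' : GoodGraph G' := by
    refine good_sub H G' f e.injective hgood hp ⟨e.symm v, ?_⟩
    rw [← hv]
    unfold vdeg
    refine Nat.card_congr (e.subtypeEquiv ?_)
    intro a
    show G'.Adj _ _ ↔ H.Adj _ _
    rw [hadj, e.apply_symm_apply]
    simp [hvu, hvw]
  have hcard : Nat.card G'.edgeSet < Nat.card H.edgeSet := by
    rw [Nat.card_coe_set_eq, Nat.card_coe_set_eq,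
      ← Set.ncard_image_of_injective _ (Sym2.map.injective e.injective)]
    apply Set.ncard_lt_ncard _ (Set.toFinite _)
    rw [Set.ssubset_iff_of_subset]
    · refine ⟨s(u, w), huw, ?_⟩
      rintro ⟨x, hx, hx'⟩
      induction x with | h a b => exact hx.2 hx'
    · rintro _ ⟨x, hx, rfl⟩
      induction x with | h a b => exact hx.1
  have hcol : TotallyColorable G' 7 := by
    by_contra hc
    have := hm _ G' hgood' hc
    omega
  obtain ⟨cv, ce, h1, h2, h3⟩ := hcol
  have hadj' : ∀ a b, H.Adj a b → s(a, b) ≠ s(u, w) → G'.Adj (e.symm a) (e.symm b) := by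
    intro a b h h'
    rw [hadj, e.apply_symm_apply, e.apply_symm_apply]; exact ⟨h, h'⟩
  refine ⟨fun a => cv (e.symm a), fun x => ce (Sym2.map e.symm x), ?_, ?_, ?_⟩
  · intro a b h h'
    exact h1 (hadj' a b h h')
  · intro a b c hb hc hbc hb' hc'
    refine h2 _ (hadj' a b hb hb') _ (hadj' a c hc hc') ?_ ⟨e.symm a, by simp, by simp⟩
    simp [hbc]
    intro h h'
    exact hbc (h'.trans h)
  · intro a b h h'
    exact h3 (hadj' a b h h')
end NC2

open SimpleGraph
namespace NC2

/-- partial total coloring where the vertices in `Sp` are uncolored -/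
structure PC {V : Type*} (H : SimpleGraph V) (Sp : V → Prop) (cv : V → Fin 7)
    (f : V → V → Option (Fin 7)) : Prop where
  symm : ∀ a b, f a b = f b a
  proper : ∀ a b c k, H.Adj a b → H.Adj a c → b ≠ c → f a b = some k → f a c ≠ some k
  ve : ∀ a b, H.Adj a b → ¬ Sp a → f a b ≠ some (cv a)

/-- color k is missing at a -/
def Miss {V : Type*} (H : SimpleGraph V) (Sp : V → Prop) (cv : V → Fin 7)
    (f : V → V → Option (Fin 7)) (a : V) (k : Fin 7) : Prop :=
  (¬ Sp a → cv a ≠ k) ∧ ∀ b, H.Adj a b → f a b ≠ some k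

section
variable {V : Type*} {H : SimpleGraph V} {Sp : V → Prop} {cv : V → Fin 7}

lemma unc {f : V → V → Option (Fin 7)} (hP : PC H Sp cv f) {a b : V} {k : Fin 7} (hab : H.Adj a b)
    (hf : f a b = some k) : ∃ f', PC H Sp cv f' ∧ f' a b = none ∧ f' b a = none ∧
      Miss H Sp cv f' a k ∧ Miss H Sp cv f' b k ∧
      (∀ c j, Miss H Sp cv f c j → Miss H Sp cv f' c j) ∧
      (∀ c d, ¬ (c = a ∧ d = b) → ¬ (c = b ∧ d = a) → f' c d = f c d) ∧
      (∀ c d, f' c d = none → f c d = none ∨ s(c, d) = s(a, b)) := by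
  classical
  obtain ⟨h1, h2, h3⟩ := hP
  refine ⟨fun c d => if (c = a ∧ d = b) ∨ (c = b ∧ d = a) then none else f c d,
    ⟨?_, ?_, ?_⟩, ?_, ?_, ⟨?_, ?_⟩, ⟨?_, ?_⟩, ?_, ?_, ?_⟩
  · grind
  · grind
  · grind
  · grind
  · grind
  · intro h h'; exact h3 a b hab h (by rw [hf, h'])
  · intro c hc
    have := h2 a b c k hab hc
    grind
  · intro h h'; exact h3 b a hab.symm h (by rw [h1, hf, h'])
  · intro c hc
    have := h2 b a c k hab.symm hc
    grind
  · rintro c j ⟨h4, h5⟩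
    refine ⟨h4, fun d hd => ?_⟩
    have := h5 d hd
    grind
  · grind
  · intro c d h
    by_cases hh : (c = a ∧ d = b) ∨ (c = b ∧ d = a) <;> simp_all

lemma setc {f : V → V → Option (Fin 7)} (hP : PC H Sp cv f) {a b : V} {k : Fin 7}
    (hab : a ≠ b) (ha : Miss H Sp cv f a k) (hb : Miss H Sp cv f b k) :
    ∃ f', PC H Sp cv f' ∧ f' a b = some k ∧ f' b a = some k ∧
      (∀ c j, Miss H Sp cv f c j → (j ≠ k ∨ (c ≠ a ∧ c ≠ b)) → Miss H Sp cv f' c j) ∧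
      (∀ c d, ¬ (c = a ∧ d = b) → ¬ (c = b ∧ d = a) → f' c d = f c d) ∧
      (∀ c d, f' c d = none → f c d = none ∧ s(c, d) ≠ s(a, b)) := by
  classical
  obtain ⟨h1, h2, h3⟩ := hP
  obtain ⟨a1, a2⟩ := ha
  obtain ⟨b1, b2⟩ := hb
  refine ⟨fun c d => if (c = a ∧ d = b) ∨ (c = b ∧ d = a) then some k else f c d,
    ⟨?_, ?_, ?_⟩, ?_, ?_, ?_, ?_, ?_⟩
  · grind
  · intro c d e j hd he hde
    have := h2 c d e j hd he hde
    have := a2 d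
    have := a2 e
    have := b2 d
    have := b2 e
    grind
  · grind
  · grind
  · grind
  · rintro c j ⟨h4, h5⟩ h6
    refine ⟨h4, fun d hd => ?_⟩
    have := h5 d hd
    grind
  · grind
  · intro c d h
    by_cases hh : (c = a ∧ d = b) ∨ (c = b ∧ d = a) <;> simp_all

/-- move color a to the edge vz and the old color of vz to the edge vx -/
lemma shift {f : V → V → Option (Fin 7)} (hP : PC H Sp cv f) {v x z : V} {a g : Fin 7}
    (hx : H.Adj v x) (hz : H.Adj v z) (hxz : x ≠ z) (hg : f v z = some g)
    (hva : Miss H Sp cv f v a) (hza : Miss H Sp cv f z a) (hxg : Miss H Sp cv f x g)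
    (hag : a ≠ g) :
    ∃ f', PC H Sp cv f' ∧ f' v x = some g ∧ f' x v = some g ∧ f' v z = some a ∧ f' z v = some a ∧
      (∀ c j, Miss H Sp cv f c j → c ≠ v → c ≠ x → c ≠ z → Miss H Sp cv f' c j) ∧
      Miss H Sp cv f' z g ∧
      (∀ c d, c ≠ v → d ≠ v → f' c d = f c d) ∧
      (∀ d, d ≠ x → d ≠ z → f' v d = f v d ∧ f' d v = f d v) ∧
      (∀ c d, f' c d = none → f c d = none ∧ s(c, d) ≠ s(v, x)) := by
  have := hx.ne
  have := hz.ne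
  obtain ⟨f1, P1, n1, n1', m1, m1', k1, e1, w1⟩ := unc hP hz hg
  obtain ⟨f2, P2, n2, n2', k2, e2, w2⟩ := setc P1 hz.ne (k1 _ _ hva) (k1 _ _ hza)
  obtain ⟨f3, P3, n3, n3', k3, e3, w3⟩ := setc (k := g) P2 hx.ne (by grind) (by grind)
  refine ⟨f3, P3, ?_, ?_, ?_, ?_, ?_, ?_, ?_, ?_, ?_⟩
  case refine_9 =>
    intro c d h
    have h1 := w3 c d h
    have h2 := w2 c d h1.1
    have h3 := w1 c d h2.1
    tauto
  all_goals clear w1 w2 w3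
  all_goals grind
end

set_option maxHeartbeats 4000000 in
theorem core {V : Type*} {H : SimpleGraph V} {Sp : V → Prop} {cv : V → Fin 7}
    {f : V → V → Option (Fin 7)} (hP : PC H Sp cv f) {v x1 x2 x3 y u1 u2 u3 w : V} {a : Fin 7}
    (hvx1 : H.Adj v x1) (hvx2 : H.Adj v x2) (hvx3 : H.Adj v x3) (hvy : H.Adj v y)
    (h12 : x1 ≠ x2) (h13 : x1 ≠ x3) (h23 : x2 ≠ x3) (hy1 : y ≠ x1) (hy2 : y ≠ x2) (hy3 : y ≠ x3)
    (hx1 : H.Adj x1 u1) (hu12 : H.Adj u1 u2) (hyu2 : H.Adj y u2) (hyu3 : H.Adj y u3)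
    (hx2 : H.Adj x2 u3)
    (hu1v : u1 ≠ v) (hu2v : u2 ≠ v) (hu3v : u3 ≠ v) (hu23 : u2 ≠ u3)
    (q1 : u1 ≠ x2) (q2 : u1 ≠ x3) (q3 : u1 ≠ y) (q4 : u2 ≠ x1) (q5 : u2 ≠ x2) (q6 : u2 ≠ x3)
    (q7 : u3 ≠ x1) (q8 : u3 ≠ x3) (hwv : w ≠ v) (hw : H.Adj x3 w)
    (w1 : w ≠ x1) (w2 : w ≠ x2) (w3 : w ≠ y)
    (N1 : ∀ z, H.Adj x1 z → z = v ∨ z = u1) (N2 : ∀ z, H.Adj x2 z → z = v ∨ z = u3)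
    (N3 : ∀ z, H.Adj x3 z → z = v ∨ z = w) (Ny : ∀ z, H.Adj y z → z = v ∨ z = u2 ∨ z = u3)
    (S1 : Sp x1) (S2 : Sp x2) (S3 : Sp x3) (Sy : Sp y)
    (hnone : f v x2 = none)
    (hsome : ∀ c d, H.Adj c d → f c d = none → s(c, d) = s(v, x2))
    (ha : f x2 u3 = some a) (hva : Miss H Sp cv f v a) :
    ∃ f', PC H Sp cv f' ∧ ∀ c d, H.Adj c d → f' c d ≠ none := by
  have M1 : ∀ (f : V → V → Option (Fin 7)) k, f x1 v ≠ some k → f x1 u1 ≠ some k →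
      Miss H Sp cv f x1 k := by
    intro f k h1 h2
    exact ⟨fun h => absurd S1 h, fun b hb => by rcases N1 b hb with rfl | rfl <;> assumption⟩
  have M2 : ∀ (f : V → V → Option (Fin 7)) k, f x2 v ≠ some k → f x2 u3 ≠ some k →
      Miss H Sp cv f x2 k := by
    intro f k h1 h2
    exact ⟨fun h => absurd S2 h, fun b hb => by rcases N2 b hb with rfl | rfl <;> assumption⟩
  have M3 : ∀ (f : V → V → Option (Fin 7)) k, f x3 v ≠ some k → f x3 w ≠ some k →
      Miss H Sp cv f x3 k := by
    intro f k h1 h2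
    exact ⟨fun h => absurd S3 h, fun b hb => by rcases N3 b hb with rfl | rfl <;> assumption⟩
  have My : ∀ (f : V → V → Option (Fin 7)) k, f y v ≠ some k → f y u2 ≠ some k →
      f y u3 ≠ some k → Miss H Sp cv f y k := by
    intro f k h1 h2 h3
    exact ⟨fun h => absurd Sy h, fun b hb => by rcases Ny b hb with rfl | rfl | rfl <;> assumption⟩
  have sy := hP.symm
  have ex : ∀ c d, H.Adj c d → ¬ (c = v ∧ d = x2) → ¬ (c = x2 ∧ d = v) → ∃ k, f c d = some k := by
    intro c d h h1 h2
    rcases h3 : f c d with _ | k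
    · have := hsome c d h h3
      simp at this
      tauto
    · exact ⟨k, rfl⟩
  have e1 := hvx1.ne
  have e2 := hvx2.ne
  have e3 := hvx3.ne
  have e4 := hvy.ne
  have e5 := hx1.ne
  have e6 := hu12.ne
  have e7 := hyu2.ne
  have e8 := hyu3.ne
  have e9 := hx2.ne
  have e10 := hw.ne
  obtain ⟨g1, hg1⟩ := ex v x1 hvx1 (by grind) (by grind)
  obtain ⟨g3, hg3⟩ := ex v y hvy (by grind) (by grind)
  obtain ⟨g4, hg4⟩ := ex v x3 hvx3 (by grind) (by grind)
  obtain ⟨b, hb⟩ := ex u1 u2 hu12 (by grind) (by grind)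
  obtain ⟨c, hc⟩ := ex y u3 hyu3 (by grind) (by grind)
  have ag1 : a ≠ g1 := fun h => hva.2 x1 hvx1 (h ▸ hg1)
  have ag3 : a ≠ g3 := fun h => hva.2 y hvy (h ▸ hg3)
  have ag4 : a ≠ g4 := fun h => hva.2 x3 hvx3 (h ▸ hg4)
  have g13 : g1 ≠ g3 := fun h => hP.proper v x1 y g1 hvx1 hvy hy1.symm hg1 (h ▸ hg3)
  have g14 : g1 ≠ g4 := fun h => hP.proper v x1 x3 g1 hvx1 hvx3 h13 hg1 (h ▸ hg4)
  have ac : a ≠ c := fun h => hP.proper u3 x2 y a hx2.symm hyu3.symm hy2.symm (by rw [sy, ha])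
    (by rw [sy, hc, h])
  have cg3 : c ≠ g3 := fun h => hP.proper y v u3 c hvy.symm hyu3 hu3v.symm (by rw [sy, hg3, h]) hc
  have hn' : f x2 v = none := by rw [sy, hnone]
  -- direct shifts
  by_cases c1 : f x1 u1 = some a
  swap
  · obtain ⟨f', P', -, -, -, -, -, -, -, -, r⟩ := shift hP hvx2 hvx1 h12.symm hg1 hva (M1 f a (by grind) c1)
      (M2 f g1 (by grind) (by grind)) ag1
    exact ⟨f', P', fun c d hcd hn => (r c d hn).2 (hsome c d hcd (r c d hn).1)⟩
  by_cases c2 : f y u2 = some a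
  swap
  · obtain ⟨f', P', -, -, -, -, -, -, -, -, r⟩ := shift hP hvx2 hvy hy2.symm hg3 hva (My f a (by grind) c2 (by grind))
      (M2 f g3 (by grind) (by grind)) ag3
    exact ⟨f', P', fun c d hcd hn => (r c d hn).2 (hsome c d hcd (r c d hn).1)⟩
  by_cases c3 : f x3 w = some a
  swap
  · obtain ⟨f', P', -, -, -, -, -, -, -, -, r⟩ := shift hP hvx2 hvx3 h23 hg4 hva (M3 f a (by grind) c3)
      (M2 f g4 (by grind) (by grind)) ag4
    exact ⟨f', P', fun c d hcd hn => (r c d hn).2 (hsome c d hcd (r c d hn).1)⟩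
  have ab : a ≠ b := fun h => hP.proper u1 x1 u2 a hx1.symm hu12 q4.symm (by rw [sy, c1])
    (by rw [hb, h])
  have u13 : u1 ≠ u3 := by
    rintro rfl
    exact hP.proper u1 x1 x2 a hx1.symm hx2.symm h12 (by rw [sy, c1]) (by rw [sy, ha])
  -- uncolor the path
  obtain ⟨f1, P1, n1, n1', m1, m1', k1, r1, D1⟩ := unc hP hx1 c1
  obtain ⟨f2, P2, n2, n2', m2, m2', k2, r2, D2⟩ := unc (k := b) P1 hu12 (by grind)
  obtain ⟨f3, P3, n3, n3', m3, m3', k3, r3, D3⟩ := unc (k := a) P2 hyu2 (by grind)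
  have A1 : Miss H Sp cv f3 u1 a := k3 _ _ (k2 _ _ m1')
  have A2 : Miss H Sp cv f3 u2 a := m3'
  have B1 : Miss H Sp cv f3 u1 b := k3 _ _ m2
  have B2 : Miss H Sp cv f3 u2 b := k3 _ _ m2'
  have A0 : Miss H Sp cv f3 x1 a := k3 _ _ (k2 _ _ m1)
  have Ay : Miss H Sp cv f3 y a := m3
  have Av : Miss H Sp cv f3 v a := k3 _ _ (k2 _ _ (k1 _ _ hva))
  have v1 : f3 v x1 = some g1 := by grind
  have v3 : f3 v y = some g3 := by grind
  have v3' : f3 y v = some g3 := by grind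
  have v1' : f3 x1 v = some g1 := by grind
  have v4 : f3 v x3 = some g4 := by grind
  have v5 : f3 x2 u3 = some a := by grind
  have v6 : f3 y u3 = some c := by grind
  have v7 : f3 x2 v = none := by grind
  have v8 : f3 x3 w = some a := by grind
  have v9 : f3 x1 u1 = none := by grind
  have dom : ∀ c d, H.Adj c d → f3 c d = none → s(c, d) = s(v, x2) ∨
      s(c, d) = s(x1, u1) ∨ s(c, d) = s(u1, u2) ∨ s(c, d) = s(y, u2) := by
    intro c d hcd h
    have h0 := hsome c d hcd
    have h1 := D1 c d
    have h2 := D2 c d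
    have h3 := D3 c d
    clear * - h h0 h1 h2 h3
    tauto
  clear k1 k2 k3 r1 r2 r3 hsome ex D1 D2 D3
  by_cases hbc : b = c
  swap
  · by_cases hb3 : b = g3
    · obtain ⟨f4, P4, s1, s2, s3, s4, s5, s6, s7, s8, D4⟩ := shift P3 hvx2 hvy hy2.symm v3 Av Ay
        (M2 f3 g3 (by grind) (by grind)) ag3
      obtain ⟨f5, P5, t1, t1', t2, t3, D5⟩ := setc (k := b) P4 hx1.ne (M1 _ _ (by grind) (by grind)) (s5 _ _ B1 (by grind) (by grind) (by grind))
      obtain ⟨f6, P6, o1, o1', o2, o3, D6⟩ := setc (k := a) P5 hu12.ne (t2 _ _ (s5 _ _ A1 (by grind) (by grind) (by grind)) (by grind))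
        (t2 _ _ (s5 _ _ A2 (by grind) (by grind) (by grind)) (by grind))
      obtain ⟨f7, P7, p1, p1', p2, p3, D7⟩ := setc (k := b) P6 hyu2.ne
        (o2 _ _ (t2 _ _ (hb3 ▸ s6) (by grind)) (by grind))
        (o2 _ _ (t2 _ _ (s5 _ _ B2 (by grind) (by grind) (by grind)) (by grind)) (by grind))
      refine ⟨f7, P7, fun c d hcd hn => ?_⟩
      have h0 := dom c d hcd
      have h4 := D4 c d
      have h5 := D5 c d
      have h6 := D6 c d
      have h7 := D7 c d
      clear * - hn h0 h4 h5 h6 h7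
      tauto
    · obtain ⟨f4, P4, s1, s2, s3, s4, s5, s6, s7, s8, D4⟩ := shift P3 hvx2 hvx1 h12.symm v1 Av A0
        (M2 f3 g1 (by grind) (by grind)) ag1
      obtain ⟨f5, P5, t1, t1', t2, t3, D5⟩ := setc (k := b) P4 hx1.ne (M1 _ _ (by grind) (by grind)) (s5 _ _ B1 (by grind) (by grind) (by grind))
      obtain ⟨f6, P6, o1, o1', o2, o3, D6⟩ := setc (k := a) P5 hu12.ne (t2 _ _ (s5 _ _ A1 (by grind) (by grind) (by grind)) (by grind))
        (t2 _ _ (s5 _ _ A2 (by grind) (by grind) (by grind)) (by grind))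
      obtain ⟨f7, P7, p1, p1', p2, p3, D7⟩ := setc (k := b) P6 hyu2.ne
        (o2 _ _ (t2 _ _ (s5 _ _ (My f3 b (by grind) (by grind) (by grind)) (by grind) (by grind) (by grind)) (by grind)) (by grind))
        (o2 _ _ (t2 _ _ (s5 _ _ B2 (by grind) (by grind) (by grind)) (by grind)) (by grind))
      refine ⟨f7, P7, fun c d hcd hn => ?_⟩
      have h0 := dom c d hcd
      have h4 := D4 c d
      have h5 := D5 c d
      have h6 := D6 c d
      have h7 := D7 c d
      clear * - hn h0 h4 h5 h6 h7
      tauto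
  · subst hbc
    -- finish the swap along the path
    obtain ⟨f4, P4, n4, n4', m4, m4', k4, r4, D4⟩ := unc (k := b) P3 hyu3 (by grind)
    obtain ⟨f5, P5, n5, n5', m5, m5', k5, r5, D5⟩ := unc (k := a) P4 hx2 (by grind)
    have K : ∀ z j, Miss H Sp cv f3 z j → Miss H Sp cv f5 z j := fun z j h => k5 _ _ (k4 _ _ h)
    obtain ⟨f6, P6, o1, o1', o2, o3, D6⟩ := setc (k := a) P5 hu12.ne (K _ _ A1) (K _ _ A2)
    obtain ⟨f7, P7, p1, p1', p2, p3, D7⟩ := setc (k := b) P6 hyu2.ne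
      (o2 _ _ (k5 _ _ m4) (by grind)) (o2 _ _ (K _ _ B2) (by grind))
    obtain ⟨f8, P8, t1, t1', t2, t3, D8⟩ := setc (k := a) P7 hyu3.ne
      (p2 _ _ (o2 _ _ (K _ _ Ay) (by grind)) (by grind)) (p2 _ _ (o2 _ _ m5' (by grind)) (by grind))
    have K' : ∀ z j, Miss H Sp cv f3 z j → z ≠ u1 → z ≠ u2 → z ≠ y → z ≠ u3 → Miss H Sp cv f8 z j := by
      intro z j h h1 h2 h3 h4
      exact t2 _ _ (p2 _ _ (o2 _ _ (K _ _ h) (by grind)) (by grind)) (by grind)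
    have Bu3 : Miss H Sp cv f8 u3 b := t2 _ _ (p2 _ _ (o2 _ _ (k5 _ _ m4') (by grind)) (by grind)) (by grind)
    have Bu1 : Miss H Sp cv f8 u1 b := t2 _ _ (p2 _ _ (o2 _ _ (K _ _ B1) (by grind)) (by grind)) (by grind)
    have Av8 := K' v a Av (by grind) (by grind) (by grind) (by grind)
    have A08 := K' x1 a A0 (by grind) (by grind) (by grind) (by grind)
    have z1 : f8 v x1 = some g1 := by grind
    have z2 : f8 v x3 = some g4 := by grind
    have z3 : f8 x2 u3 = none := by grind
    have z4 : f8 x2 v = none := by grind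
    have z5 : f8 x3 w = some a := by grind
    have z6 : f8 v y = some g3 := by grind
    have z7 : f8 x1 u1 = none := by grind
    have z8 : f8 x3 v = some g4 := by rw [P8.symm, z2]
    have dom8 : ∀ c d, H.Adj c d → f8 c d = none → s(c, d) = s(v, x2) ∨
        s(c, d) = s(x1, u1) ∨ s(c, d) = s(x2, u3) := by
      intro c d hcd h
      have h0 := dom c d hcd
      have h4 := D4 c d
      have h5 := D5 c d
      have h6 := D6 c d
      have h7 := D7 c d
      have h8 := D8 c d
      clear * - h h0 h4 h5 h6 h7 h8
      tauto
    clear K K' k4 k5 r4 r5 o2 o3 p2 p3 t2 t3 dom D4 D5 D6 D7 D8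
    by_cases hb1 : b = g1
    · -- rotate the colors of vx1, vx2, vx3
      obtain ⟨f9, P9, s1, s2, s3, s4, s5, s6, s7, s8, D9⟩ := shift P8 hvx2 hvx1 h12.symm z1 Av8 A08
        (M2 f8 g1 (by grind) (by grind)) ag1
      obtain ⟨f10, P10, n10, n10', m10, m10', k10, r10, D10⟩ := unc (k := g1) P9 hvx2 s1
      obtain ⟨f11, P11, a1, a2, a3, a4, a5, a6, a7, a8, D11⟩ := shift (g := g4) (a := g1) P10 hvx2 hvx3 h23 (by grind)
        m10 (M3 _ _ (by grind) (by grind)) (M2 _ _ (by grind) (by grind)) g14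
      obtain ⟨f12, P12, b1, b1', b2, b3, D12⟩ := setc (k := b) P11 hx1.ne (M1 _ _ (by grind) (by grind))
        (a5 _ _ (k10 _ _ (s5 _ _ Bu1 (by grind) (by grind) (by grind))) (by grind) (by grind) (by grind))
      obtain ⟨f13, P13, d1, d1', d2, d3, D13⟩ := setc (k := b) P12 hx2.ne (M2 _ _ (by grind) (by grind))
        (b2 _ _ (a5 _ _ (k10 _ _ (s5 _ _ Bu3 (by grind) (by grind) (by grind))) (by grind) (by grind) (by grind)) (by grind))
      refine ⟨f13, P13, fun c d hcd hn => ?_⟩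
      have h0 := dom8 c d hcd
      have h9 := D9 c d
      have h10 := D10 c d
      have h11 := D11 c d
      have h12 := D12 c d
      have h13 := D13 c d
      clear * - hn h0 h9 h10 h11 h12 h13
      tauto
    · obtain ⟨f9, P9, s1, s2, s3, s4, s5, s6, s7, s8, D9⟩ := shift P8 hvx2 hvx1 h12.symm z1 Av8 A08
        (M2 f8 g1 (by grind) (by grind)) ag1
      obtain ⟨f10, P10, b1, b1', b2, b3, D10⟩ := setc (k := b) P9 hx1.ne (M1 _ _ (by grind) (by grind))
        (s5 _ _ Bu1 (by grind) (by grind) (by grind))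
      obtain ⟨f11, P11, d1, d1', d2, d3, D11⟩ := setc (k := b) P10 hx2.ne (M2 _ _ (by grind) (by grind))
        (b2 _ _ (s5 _ _ Bu3 (by grind) (by grind) (by grind)) (by grind))
      refine ⟨f11, P11, fun c d hcd hn => ?_⟩
      have h0 := dom8 c d hcd
      have h9 := D9 c d
      have h10 := D10 c d
      have h11 := D11 c d
      clear * - hn h0 h9 h10 h11
      tauto
end NC2

open SimpleGraph
namespace NC2

lemma free_color {V : Type*} [Fintype V] (H : SimpleGraph V) (z : V) (hz : vdeg H z ≤ 3)
    (p q : V → Fin 7) : ∃ k, ∀ b, H.Adj z b → p b ≠ k ∧ q b ≠ k := by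
  classical
  have hc : (H.neighborFinset z).card ≤ 3 := by
    have : vdeg H z = (H.neighborFinset z).card := by
      unfold vdeg
      rw [Nat.card_eq_fintype_card, H.card_neighborSet_eq_degree, H.card_neighborFinset_eq_degree]
    omega
  by_contra! hcon
  have hsub : (Finset.univ : Finset (Fin 7)) ⊆
      (H.neighborFinset z).image p ∪ (H.neighborFinset z).image q := by
    intro k _
    obtain ⟨b, hb, h⟩ := hcon k
    rw [Finset.mem_union, Finset.mem_image, Finset.mem_image]
    by_cases hp : p b = k
    · exact Or.inl ⟨b, by simpa using hb, hp⟩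
    · exact Or.inr ⟨b, by simpa using hb, h hp⟩
  have h1 := Finset.card_le_card hsub
  have h2 := Finset.card_union_le ((H.neighborFinset z).image p) ((H.neighborFinset z).image q)
  have h3 := Finset.card_image_le (s := H.neighborFinset z) (f := p)
  have h4 := Finset.card_image_le (s := H.neighborFinset z) (f := q)
  simp only [Finset.card_univ, Fintype.card_fin] at h1
  omega

lemma fill {V : Type*} [Fintype V] {H : SimpleGraph V} {Sp : V → Prop} {cv : V → Fin 7}
    {f : V → V → Option (Fin 7)} (hP : PC H Sp cv f)
    (hall : ∀ c d, H.Adj c d → f c d ≠ none)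
    (hind : ∀ c d, H.Adj c d → Sp c → ¬ Sp d)
    (hdeg : ∀ c, Sp c → vdeg H c ≤ 3)
    (hcv : ∀ c d, H.Adj c d → ¬ Sp c → ¬ Sp d → cv c ≠ cv d) : TotallyColorable H 7 := by
  classical
  let g : V → V → Fin 7 := fun c d => (f c d).getD 0
  have gs : ∀ c d, H.Adj c d → f c d = some (g c d) := by
    intro c d h
    rcases h' : f c d with _ | k
    · exact absurd h' (hall c d h)
    · simp [g, h']
  have gsym : ∀ c d, g c d = g d c := fun c d => by simp only [g, hP.symm c d]
  have hk : ∀ z, ∃ k, Sp z → ∀ b, H.Adj z b → cv b ≠ k ∧ g z b ≠ k := by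
    intro z
    by_cases hz : Sp z
    · obtain ⟨k, hk⟩ := free_color H z (hdeg z hz) cv (g z)
      exact ⟨k, fun _ => hk⟩
    · exact ⟨0, fun h => absurd h hz⟩
  choose n hn using hk
  have prop : ∀ a b c, H.Adj a b → H.Adj a c → b ≠ c → g a b ≠ g a c := by
    intro a b c h1 h2 h3 h4
    exact hP.proper a b c _ h1 h2 h3 (gs a b h1) (h4 ▸ gs a c h2)
  refine ⟨fun z => if Sp z then n z else cv z, Sym2.lift ⟨g, gsym⟩, ?_, ?_, ?_⟩
  · intro c d h
    by_cases h1 : Sp c <;> by_cases h2 : Sp d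
    · exact absurd h2 (hind c d h h1)
    · simp only [h1, h2, if_true, if_false]
      exact (hn c h1 d h).1.symm
    · simp only [h1, h2, if_true, if_false]
      exact (hn d h2 c h.symm).1
    · simp only [h1, h2, if_false]
      exact hcv c d h h1 h2
  · rintro e₁ he₁ e₂ he₂ hne ⟨x, hx1, hx2⟩
    obtain ⟨p, rfl⟩ := Sym2.mem_iff_exists.1 hx1
    obtain ⟨q, rfl⟩ := Sym2.mem_iff_exists.1 hx2
    rw [mem_edgeSet] at he₁ he₂
    simp only [Sym2.lift_mk]
    exact prop x p q he₁ he₂ (fun h => hne (by rw [h]))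
  · intro c d h
    simp only [Sym2.lift_mk]
    by_cases h1 : Sp c
    · simp only [h1, if_true]
      exact (hn c h1 d h).2
    · simp only [h1, if_false]
      intro h2
      exact hP.ve c d h h1 (h2 ▸ gs c d h)

/-- a colour missing at a vertex of degree at most six with an uncoloured edge -/
lemma miss_exists {V : Type*} [Fintype V] {H : SimpleGraph V} {Sp : V → Prop} {cv : V → Fin 7}
    {f : V → V → Option (Fin 7)} (z b : V) (hz : vdeg H z ≤ 6) (hb : H.Adj z b)
    (hf : f z b = none) : ∃ k, Miss H Sp cv f z k := by
  classical
  have hc : (H.neighborFinset z).card ≤ 6 := by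
    have : vdeg H z = (H.neighborFinset z).card := by
      unfold vdeg
      rw [Nat.card_eq_fintype_card, H.card_neighborSet_eq_degree, H.card_neighborFinset_eq_degree]
    omega
  by_contra! hcon
  have hsub : (Finset.univ : Finset (Fin 7)) ⊆
      insert (cv z) (((H.neighborFinset z).erase b).image fun c => (f z c).getD 0) := by
    intro k _
    by_contra hk
    rw [Finset.mem_insert, Finset.mem_image] at hk
    push Not at hk
    refine hcon k ⟨fun _ h => hk.1 h.symm, fun c hc h => ?_⟩
    refine hk.2 c ?_ (by simp [h])
    rw [Finset.mem_erase]
    refine ⟨?_, by simpa using hc⟩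
    rintro rfl
    simp [hf] at h
  have h1 := Finset.card_le_card hsub
  have h2 := Finset.card_insert_le (cv z) (((H.neighborFinset z).erase b).image fun c => (f z c).getD 0)
  have h3 := Finset.card_image_le (s := (H.neighborFinset z).erase b) (f := fun c => (f z c).getD 0)
  have h4 := Finset.card_erase_of_mem (s := H.neighborFinset z) (a := b) (by simpa using hb)
  simp only [Finset.card_univ, Fintype.card_fin] at h1
  omega

lemma deg_two {V : Type*} [Fintype V] {H : SimpleGraph V} {x v : V} (h : vdeg H x = 2)
    (hv : H.Adj x v) : ∃ u, u ≠ v ∧ H.Adj x u ∧ ∀ z, H.Adj x z → z = v ∨ z = u := by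
  classical
  have hc : (H.neighborFinset x).card = 2 := by
    rw [← h]
    unfold vdeg
    rw [Nat.card_eq_fintype_card, H.card_neighborSet_eq_degree, H.card_neighborFinset_eq_degree]
  obtain ⟨p, q, hpq, hs⟩ := Finset.card_eq_two.1 hc
  have hm : ∀ z, H.Adj x z ↔ z = p ∨ z = q := by
    intro z
    rw [← mem_neighborFinset, hs]
    simp
  rcases (hm v).1 hv with rfl | rfl
  · exact ⟨q, hpq.symm, (hm q).2 (Or.inr rfl), fun z hz => (hm z).1 hz⟩
  · exact ⟨p, hpq, (hm p).2 (Or.inl rfl), fun z hz => ((hm z).1 hz).symm⟩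

lemma house_mem {V : Type*} {H : SimpleGraph V} {a b c d e : V} (h1 : H.Adj a b) (h2 : H.Adj b c)
    (h3 : H.Adj c d) (h4 : H.Adj d e) (h5 : H.Adj e a) (h6 : H.Adj b e) (n1 : a ≠ c) (n2 : a ≠ d)
    (n3 : b ≠ d) (n4 : c ≠ e) : ContainsCopy houseGraph H := by
  have := h1.ne
  have := h2.ne
  have := h3.ne
  have := h4.ne
  have := h5.ne
  have := h6.ne
  refine ⟨![a, b, c, d, e], ?_, ?_⟩
  · intro i j hij
    fin_cases i <;> fin_cases j <;> simp at hij ⊢ <;> simp_all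
  · intro i j hij
    simp only [houseGraph, fromEdgeSet_adj] at hij
    obtain ⟨hij, _⟩ := hij
    simp only [Set.mem_insert_iff, Set.mem_singleton_iff, Sym2.eq_iff] at hij
    rcases hij with (⟨rfl, rfl⟩ | ⟨rfl, rfl⟩) | (⟨rfl, rfl⟩ | ⟨rfl, rfl⟩) | (⟨rfl, rfl⟩ | ⟨rfl, rfl⟩) |
      (⟨rfl, rfl⟩ | ⟨rfl, rfl⟩) | (⟨rfl, rfl⟩ | ⟨rfl, rfl⟩) | (⟨rfl, rfl⟩ | ⟨rfl, rfl⟩) <;> simp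
    all_goals first | assumption | (apply SimpleGraph.Adj.symm; assumption)

set_option maxHeartbeats 1000000 in
theorem main {V : Type*} [Fintype V] (H : SimpleGraph V)
    (hmin : MinimalCounterexample H) (v x1 x2 x3 y u1 u2 u3 : V) (hv : vdeg H v = 6)
    (h12 : x1 ≠ x2) (h13 : x1 ≠ x3) (h23 : x2 ≠ x3) (hy1 : y ≠ x1) (hy2 : y ≠ x2) (hy3 : y ≠ x3)
    (hvx1 : H.Adj v x1) (hvx2 : H.Adj v x2) (hvx3 : H.Adj v x3) (hvy : H.Adj v y)
    (d1 : vdeg H x1 = 2) (d2 : vdeg H x2 = 2) (d3 : vdeg H x3 = 2) (dy : vdeg H y = 3)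
    (ny : H.neighborSet y = {v, u2, u3}) (hx1 : H.Adj x1 u1) (hu1v : u1 ≠ v) (hu12 : H.Adj u1 u2)
    (hx2 : H.Adj x2 u3) (hu3v : u3 ≠ v) : False := by
  classical
  have Ny' : ∀ z, H.Adj y z ↔ z = v ∨ z = u2 ∨ z = u3 := by
    intro z
    rw [← mem_neighborSet, ny]
    simp
  have hyu2 : H.Adj y u2 := (Ny' u2).2 (by simp)
  have hyu3 : H.Adj y u3 := (Ny' u3).2 (by simp)
  have card3 : ({v, u2, u3} : Finset V).card = 3 := by
    have h : vdeg H y = Nat.card (({v, u2, u3} : Finset V) : Set V) := by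
      unfold vdeg
      rw [ny]
      congr 2
      simp
    rw [dy] at h
    simpa using h.symm
  have hu2v : u2 ≠ v := by
    rintro rfl
    have := Finset.card_le_two (a := u2) (b := u3)
    simp only [Finset.insert_eq_of_mem, Finset.mem_insert, true_or] at card3
    omega
  have hu23 : u2 ≠ u3 := by
    rintro rfl
    have := Finset.card_le_two (a := v) (b := u2)
    simp only [Finset.insert_eq_of_mem, Finset.mem_singleton] at card3
    omega
  have N1 : ∀ z, H.Adj x1 z → z = v ∨ z = u1 := by
    obtain ⟨u, -, -, h⟩ := deg_two d1 hvx1.symm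
    have : u1 = u := by have := h _ hx1; tauto
    exact this ▸ h
  have N2 : ∀ z, H.Adj x2 z → z = v ∨ z = u3 := by
    obtain ⟨u, -, -, h⟩ := deg_two d2 hvx2.symm
    have : u3 = u := by have := h _ hx2; tauto
    exact this ▸ h
  obtain ⟨w, hwv, hw, N3⟩ := deg_two d3 hvx3.symm
  have Ny := fun z => (Ny' z).1
  have e1 := hvx1.ne
  have e2 := hvx2.ne
  have e3 := hvx3.ne
  have e4 := hvy.ne
  have e5 := hx1.ne
  have e6 := hu12.ne
  have e7 := hyu2.ne
  have e8 := hyu3.ne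
  have e9 := hx2.ne
  have e10 := hw.ne
  have q7 : u3 ≠ x1 := by
    rintro rfl
    have := N1 _ hx2.symm
    have := N1 _ hyu3.symm
    grind
  have q8 : u3 ≠ x3 := by
    rintro rfl
    have := N3 _ hx2.symm
    have := N3 _ hyu3.symm
    grind
  have q5 : u2 ≠ x2 := by
    rintro rfl
    have := N2 _ hyu2.symm
    grind
  have q4 : u2 ≠ x1 := by
    rintro rfl
    have h1 := N1 _ hyu2.symm
    refine hmin.1.2.2.2.1 (house_mem (a := u2) (b := v) (c := x2) (d := u3) (e := y) hvx1.symm hvx2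
      hx2 hyu3.symm hyu2 hvy h12 q7.symm hu3v.symm hy2.symm)
  have q3 : u1 ≠ y := by
    rintro rfl
    have := Ny _ hx1.symm
    grind
  have q1 : u1 ≠ x2 := by
    rintro rfl
    have := N2 _ hx1.symm
    grind
  have q2 : u1 ≠ x3 := by
    rintro rfl
    have := N3 _ hx1.symm
    have := N3 _ hu12
    grind
  have q6 : u2 ≠ x3 := by
    rintro rfl
    have := N3 _ hu12.symm
    have := N3 _ hyu2.symm
    grind
  have w1 : w ≠ x1 := by
    rintro rfl
    have := N1 _ hw.symm
    grind
  have w2 : w ≠ x2 := by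
    rintro rfl
    have := N2 _ hw.symm
    grind
  have w3 : w ≠ y := by
    rintro rfl
    have := Ny _ hw.symm
    grind
  let Sp : V → Prop := fun z => z = x1 ∨ z = x2 ∨ z = x3 ∨ z = y
  have S1 : Sp x1 := by simp [Sp]
  have S2 : Sp x2 := by simp [Sp]
  have S3 : Sp x3 := by simp [Sp]
  have Sy : Sp y := by simp [Sp]
  have hdeg : ∀ c, Sp c → vdeg H c ≤ 3 := by
    rintro c (rfl | rfl | rfl | rfl) <;> omega
  have hind : ∀ c d, H.Adj c d → Sp c → ¬ Sp d := by
    rintro c d h (rfl | rfl | rfl | rfl) h'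
    · rcases N1 _ h with h2 | h2 <;> rw [h2] at h' <;> rcases h' with h' | h' | h' | h' <;>
        first | exact absurd h' (by assumption) | exact absurd h'.symm (by assumption)
    · rcases N2 _ h with h2 | h2 <;> rw [h2] at h' <;> rcases h' with h' | h' | h' | h' <;>
        first | exact absurd h' (by assumption) | exact absurd h'.symm (by assumption)
    · rcases N3 _ h with h2 | h2 <;> rw [h2] at h' <;> rcases h' with h' | h' | h' | h' <;>
        first | exact absurd h' (by assumption) | exact absurd h'.symm (by assumption)
    · rcases Ny _ h with h2 | h2 | h2 <;> rw [h2] at h' <;> rcases h' with h' | h' | h' | h' <;>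
        first | exact absurd h' (by assumption) | exact absurd h'.symm (by assumption)
  obtain ⟨cv, ce, c1, c2, c3⟩ := delete_color H hmin x2 u3 v v y hx2 hv e2 hu3v.symm hvx2.symm
    hu3v.symm hyu3.symm hy2
  have hcv : ∀ c d, H.Adj c d → ¬ Sp c → ¬ Sp d → cv c ≠ cv d := by
    intro c d h hc hd
    refine c1 c d h fun h' => ?_
    rw [Sym2.eq_iff] at h'
    rcases h' with ⟨rfl, rfl⟩ | ⟨rfl, rfl⟩
    · exact hc S2
    · exact hd S2
  let f : V → V → Option (Fin 7) := fun a b => if s(a, b) = s(x2, u3) then none else some (ce s(a, b))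
  have fn : ∀ a b, f a b = none → s(a, b) = s(x2, u3) := by
    intro a b h
    by_contra h'
    simp only [f, if_neg h'] at h
    exact absurd h (by simp)
  have fs : ∀ a b k, f a b = some k → s(a, b) ≠ s(x2, u3) ∧ ce s(a, b) = k := by
    intro a b k h
    by_cases h' : s(a, b) = s(x2, u3)
    · simp only [f, if_pos h'] at h
      exact absurd h (by simp)
    · simp only [f, if_neg h'] at h
      exact ⟨h', by simpa using h⟩
  have hP : PC H Sp cv f := by
    refine ⟨?_, ?_, ?_⟩
    · intro a b
      simp only [f, Sym2.eq_swap (a := a) (b := b)]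
    · intro a b c k hab hac hbc h1 h2
      obtain ⟨p1, p2⟩ := fs _ _ _ h1
      obtain ⟨p3, p4⟩ := fs _ _ _ h2
      exact c2 a b c hab hac hbc p1 p3 (p2.trans p4.symm)
    · intro a b hab _ h
      obtain ⟨p1, p2⟩ := fs _ _ _ h
      exact c3 a b hab p1 p2
  have fx : f x2 u3 = none := by simp [f]
  have fx' : f u3 x2 = none := by rw [hP.symm, fx]
  have finish : ∀ f', PC H Sp cv f' → (∀ c d, H.Adj c d → f' c d ≠ none) → False :=
    fun f' h1 h2 => hmin.2.1 (fill h1 h2 hind hdeg hcv)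
  have M2 : ∀ (f : V → V → Option (Fin 7)) k, f x2 v ≠ some k → f x2 u3 ≠ some k →
      Miss H Sp cv f x2 k := by
    intro f k h1 h2
    exact ⟨fun h => absurd S2 h, fun b hb => by rcases N2 b hb with rfl | rfl <;> assumption⟩
  obtain ⟨k, hk⟩ := miss_exists (Sp := Sp) (cv := cv) u3 x2 (hmin.1.2.1.1 u3) hx2.symm fx'
  by_cases ha : f x2 v = some k
  · obtain ⟨f1, P1, n1, n1', m1, m1', k1, r1, D1⟩ := unc hP hvx2.symm ha
    obtain ⟨f2, P2, t1, t1', t2, t3, D2⟩ := setc (k := k) P1 hx2.ne m1 (k1 _ _ hk)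
    have hnn : f2 v x2 = none := by
      rw [t3 v x2 (fun h => e2 h.1) (fun h => hu3v h.1.symm)]
      exact n1'
    have hsome : ∀ c d, H.Adj c d → f2 c d = none → s(c, d) = s(v, x2) := by
      intro c d _ hn
      have h2 := D2 c d hn
      rw [Sym2.eq_swap (a := v)]
      rcases D1 c d h2.1 with h1 | h1
      · exact absurd (fn c d h1) h2.2
      · exact h1
    obtain ⟨f', P', h'⟩ := core P2 hvx1 hvx2 hvx3 hvy h12 h13 h23 hy1 hy2 hy3 hx1 hu12 hyu2 hyu3
      hx2 hu1v hu2v hu3v hu23 q1 q2 q3 q4 q5 q6 q7 q8 hwv hw w1 w2 w3 N1 N2 N3 Ny S1 S2 S3 Sy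
      (a := k) hnn
      hsome
      t1 (t2 _ _ m1' (Or.inr ⟨e2, hu3v.symm⟩))
    exact finish f' P' h'
  · obtain ⟨f2, P2, t1, t1', t2, t3, D2⟩ := setc (k := k) hP hx2.ne (M2 f k ha (by simp [fx])) hk
    exact finish f2 P2 fun c d hcd hn => (D2 c d hn).2 (fn c d (D2 c d hn).1)
end NC2

/-- **Forbidden configuration (2).** A minimal counterexample has no 6-vertex `v` with
three distinct neighbors `x₁, x₂, x₃` of degree 2 and a neighbor `y` of degree 3 (all
distinct), such that the neighbors of `y` are `v`, `u₂` and `u₃`, the neighbor `u₁` of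
`x₁` other than `v` is adjacent to `u₂`, and `u₃` is the neighbor of `x₂` other than `v`. -/
theorem minimal_counterexample_no_config_two
    {V : Type*} [Fintype V] (H : SimpleGraph V)
    (hmin : MinimalCounterexample H) :
    ¬ ∃ (v x₁ x₂ x₃ y u₁ u₂ u₃ : V),
      vdeg H v = 6 ∧
      x₁ ≠ x₂ ∧ x₁ ≠ x₃ ∧ x₂ ≠ x₃ ∧ y ≠ x₁ ∧ y ≠ x₂ ∧ y ≠ x₃ ∧
      H.Adj v x₁ ∧ H.Adj v x₂ ∧ H.Adj v x₃ ∧ H.Adj v y ∧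
      vdeg H x₁ = 2 ∧ vdeg H x₂ = 2 ∧ vdeg H x₃ = 2 ∧ vdeg H y = 3 ∧
      H.neighborSet y = {v, u₂, u₃} ∧
      H.Adj x₁ u₁ ∧ u₁ ≠ v ∧ H.Adj u₁ u₂ ∧
      H.Adj x₂ u₃ ∧ u₃ ≠ v := by
  rintro ⟨v, x1, x2, x3, y, u1, u2, u3, hv, h12, h13, h23, hy1, hy2, hy3, a1, a2, a3, a4,
    d1, d2, d3, dy, ny, b1, b2, b3, b4, b5⟩
  exact NC2.main H hmin v x1 x2 x3 y u1 u2 u3 hv h12 h13 h23 hy1 hy2 hy3 a1 a2 a3 a4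
    d1 d2 d3 dy ny b1 b2 b3 b4 b5
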